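/- arXiv:1501.05020 — 11 statements merged into one kernel-verified Lean document; each statement's English description precedes it below -/
import Mathlib

section
/- Let G be a bipartite graph with ordered colour classes A = (v_1,…,v_n) and B = (w_1,…,w_m) that is a k-monotone bipartite ε-expander (for some ε ∈ (0,1]). Let G' be the graph with vertex set V(G') = V(G) and edge set E(G') = { v_i w_j , v_j w_i : v_i w_j ∈ E(G) }. Then G' (with the same ordered bipartition) is a two-sided 2k-monotone bipartite ε-expander. -/
/-- In a bipartite graph with ordered colour classes `(v_1,…,v_n)` and `(w_1,…,w_m)`
(modelled as `Fin n` and `Fin m`, edges being pairs), two edges `v_i w_j` and `v_k w_ℓ`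
cross if `i < k` and `ℓ < j`.  A set of edges is a monotone matching if it is a matching
and no two of its edges cross. -/
def MonotoneMatching {n m : ℕ} (M : Finset (Fin n × Fin m)) : Prop :=
  (∀ e ∈ M, ∀ f ∈ M, e ≠ f → e.1 ≠ f.1 ∧ e.2 ≠ f.2) ∧
  (∀ e ∈ M, ∀ f ∈ M, ¬(e.1 < f.1 ∧ f.2 < e.2))

/-- A bipartite graph with ordered colour classes is `d`-monotone if its edge set is the
union of `d` monotone matchings. -/
def IsMonotoneGraph {n m : ℕ} (E : Finset (Fin n × Fin m)) (d : ℕ) : Prop :=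
  ∃ M : Fin d → Finset (Fin n × Fin m),
    (∀ t, MonotoneMatching (M t)) ∧ E = Finset.univ.biUnion M

/-- The neighbourhood of a set `S` of vertices of the first colour class. -/
def nbhdA {n m : ℕ} (E : Finset (Fin n × Fin m)) (S : Finset (Fin n)) : Finset (Fin m) :=
  (E.filter (fun e => e.1 ∈ S)).image Prod.snd

/-- The neighbourhood of a set `T` of vertices of the second colour class. -/
def nbhdB {n m : ℕ} (E : Finset (Fin n × Fin m)) (T : Finset (Fin m)) : Finset (Fin n) :=
  (E.filter (fun e => e.2 ∈ T)).image Prod.fst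

/-- A bipartite graph with colour classes of equal size `n` is a bipartite `ε`-expander
if `|N(S)| ≥ (1+ε)|S|` for every `S ⊆ A` with `|S| ≤ |A|/2`. -/
def BipExpander {n : ℕ} (E : Finset (Fin n × Fin n)) (ε : ℝ) : Prop :=
  ∀ S : Finset (Fin n), (S.card : ℝ) ≤ (n : ℝ) / 2 →
    (1 + ε) * (S.card : ℝ) ≤ ((nbhdA E S).card : ℝ)

/-- A two-sided bipartite `ε`-expander also expands subsets of the second class. -/
def TwoSidedBipExpander {n : ℕ} (E : Finset (Fin n × Fin n)) (ε : ℝ) : Prop :=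
  BipExpander E ε ∧
  ∀ T : Finset (Fin n), (T.card : ℝ) ≤ (n : ℝ) / 2 →
    (1 + ε) * (T.card : ℝ) ≤ ((nbhdB E T).card : ℝ)

theorem MonotoneMatching.image_swap {n m : ℕ} {M : Finset (Fin n × Fin m)}
    (hM : MonotoneMatching M) : MonotoneMatching (M.image Prod.swap) := by
  obtain ⟨h1, h2⟩ := hM
  simp only [MonotoneMatching, Finset.forall_mem_image]
  refine ⟨fun e he f hf hne => ?_, fun e he f hf h => h2 f hf e he ⟨h.2, h.1⟩⟩
  exact (h1 e he f hf fun h => hne (congrArg Prod.swap h)).symm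

theorem IsMonotoneGraph.image_swap {n m d : ℕ} {E : Finset (Fin n × Fin m)}
    (hE : IsMonotoneGraph E d) : IsMonotoneGraph (E.image Prod.swap) d := by
  obtain ⟨M, hM, rfl⟩ := hE
  exact ⟨fun t => (M t).image Prod.swap, fun t => (hM t).image_swap, Finset.biUnion_image⟩

theorem IsMonotoneGraph.union {n m d₁ d₂ : ℕ} {E₁ E₂ : Finset (Fin n × Fin m)}
    (h₁ : IsMonotoneGraph E₁ d₁) (h₂ : IsMonotoneGraph E₂ d₂) :
    IsMonotoneGraph (E₁ ∪ E₂) (d₁ + d₂) := by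
  obtain ⟨M₁, hM₁, rfl⟩ := h₁
  obtain ⟨M₂, hM₂, rfl⟩ := h₂
  refine ⟨Fin.append M₁ M₂, fun t => ?_, ?_⟩
  · refine Fin.addCases (fun i => ?_) (fun i => ?_) t
    · simpa using hM₁ i
    · simpa using hM₂ i
  · ext e
    simp [← finSumFinEquiv.exists_congr_right (q := fun t => e ∈ Fin.append M₁ M₂ t)]

theorem nbhdA_mono {n m : ℕ} {E F : Finset (Fin n × Fin m)} (h : E ⊆ F) (S : Finset (Fin n)) :
    nbhdA E S ⊆ nbhdA F S :=
  Finset.image_subset_image (Finset.filter_subset_filter _ h)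

theorem nbhdB_eq_nbhdA_image_swap {n m : ℕ} (E : Finset (Fin n × Fin m)) (T : Finset (Fin m)) :
    nbhdB E T = nbhdA (E.image Prod.swap) T := by
  ext v
  simp [nbhdA, nbhdB]

theorem BipExpander.mono {n : ℕ} {E F : Finset (Fin n × Fin n)} {ε : ℝ}
    (hE : BipExpander E ε) (h : E ⊆ F) : BipExpander F ε := fun S hS =>
  (hE S hS).trans (Nat.cast_le.2 (Finset.card_le_card (nbhdA_mono h S)))

/-- If `G` is a `k`-monotone bipartite `ε`-expander with ordered colour classes
`(v_1,…,v_n)`, `(w_1,…,w_n)`, then the graph `G'` with the same vertices and edge set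
`{v_i w_j, v_j w_i : v_i w_j ∈ E(G)}` is a two-sided `2k`-monotone bipartite
`ε`-expander. -/
theorem stmt0 {n k : ℕ} (ε : ℝ) (hε0 : 0 < ε) (hε1 : ε ≤ 1)
    (E : Finset (Fin n × Fin n))
    (hmono : IsMonotoneGraph E k) (hexp : BipExpander E ε) :
    IsMonotoneGraph (E ∪ E.image Prod.swap) (2 * k) ∧
    TwoSidedBipExpander (E ∪ E.image Prod.swap) ε := by
  have hswap : (E ∪ E.image Prod.swap).image Prod.swap = E ∪ E.image Prod.swap := by
    rw [Finset.image_union, Finset.image_image, Prod.swap_swap_eq, Finset.image_id,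
      Finset.union_comm]
  have hexp' : BipExpander (E ∪ E.image Prod.swap) ε := hexp.mono Finset.subset_union_left
  refine ⟨two_mul k ▸ hmono.union hmono.image_swap, hexp', fun T hT => ?_⟩
  rw [nbhdB_eq_nbhdA_image_swap, hswap]
  exact hexp' T hT
end

section
/- Let ε ∈ (0,1] and let G be a two-sided bipartite ε-expander with bipartition (A,B), maximum degree Δ, and n := |A| = |B| ≥ 3. Let k ≥ 2 be an integer, and for each vertex v of G let k_v be an integer with k ≤ k_v ≤ (1 + ε/4)k. Let G' be a bipartite graph with bipartition (X,Y) such that: G' contains pairwise disjoint cycles { C_v : v ∈ V(G) } with |C_v| = 2k_v for each v; V(G') = ⋃_{v ∈ V(G)} V(C_v); and for each edge vw of G there are edges xy and pq of G' with x ∈ C_v ∩ X, y ∈ C_w ∩ Y, p ∈ C_v ∩ Y and q ∈ C_w ∩ X. Then G' is a two-sided bipartite ε'-expander, where ε' = (k + kΔ(1+ε)/ε)^{-1}. -/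
/-- The neighbourhood `N(S)` of a set `S` of vertices: all vertices adjacent to some
vertex of `S`. -/
def Nbhd {V : Type*} (G : SimpleGraph V) (S : Set V) : Set V := {y | ∃ x ∈ S, G.Adj x y}

/-- `(A,B)` is a bipartition of the graph `G`. -/
def IsBipartition {V : Type*} (G : SimpleGraph V) (A B : Set V) : Prop :=
  A ∪ B = Set.univ ∧ Disjoint A B ∧
  ∀ x y, G.Adj x y → (x ∈ A ∧ y ∈ B) ∨ (x ∈ B ∧ y ∈ A)

/-- `G` with bipartition `(A,B)` is a two-sided bipartite `ε`-expander:
`|A| = |B|`, every `S ⊆ A` with `|S| ≤ |A|/2` has `|N(S)| ≥ (1+ε)|S|`, and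
every `T ⊆ B` with `|T| ≤ |B|/2` has `|N(T)| ≥ (1+ε)|T|`. -/
def TwoSidedBipartiteExpander {V : Type*} (G : SimpleGraph V) (A B : Set V)
    (ε : ℝ) : Prop :=
  IsBipartition G A B ∧ A.ncard = B.ncard ∧
  (∀ S ⊆ A, (S.ncard : ℝ) ≤ (A.ncard : ℝ) / 2 →
    (1 + ε) * (S.ncard : ℝ) ≤ ((Nbhd G S).ncard : ℝ)) ∧
  (∀ T ⊆ B, (T.ncard : ℝ) ≤ (B.ncard : ℝ) / 2 →
    (1 + ε) * (T.ncard : ℝ) ≤ ((Nbhd G T).ncard : ℝ))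

theorem IsBipartition.symm {V : Type*} {G : SimpleGraph V} {A B : Set V}
    (h : IsBipartition G A B) : IsBipartition G B A :=
  ⟨by rw [Set.union_comm]; exact h.1, h.2.1.symm, fun x y hxy => (h.2.2 x y hxy).symm⟩

theorem IsBipartition.mem_right {V : Type*} {G : SimpleGraph V} {A B : Set V}
    (h : IsBipartition G A B) {x y : V} (hxy : G.Adj x y) (hx : x ∈ A) : y ∈ B := by
  rcases h.2.2 x y hxy with h' | h'
  · exact h'.2
  · exact absurd h'.1 (Set.disjoint_left.1 h.2.1 hx)

theorem IsBipartition.nbhd_subset {V : Type*} {G : SimpleGraph V} {A B : Set V}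
    (h : IsBipartition G A B) {S : Set V} (hS : S ⊆ A) : Nbhd G S ⊆ B := by
  rintro y ⟨x, hx, hxy⟩
  exact h.mem_right hxy (hS hx)

theorem IsBipartition.ncard_add_ncard {V : Type*} [Finite V] {G : SimpleGraph V} {A B : Set V}
    (h : IsBipartition G A B) (F : Set V) : (F ∩ A).ncard + (F ∩ B).ncard = F.ncard := by
  rw [← Set.ncard_union_eq (h.2.1.mono Set.inter_subset_right Set.inter_subset_right),
    ← Set.inter_union_distrib_left, h.1, Set.inter_univ]

theorem TwoSidedBipartiteExpander.symm {V : Type*} {G : SimpleGraph V} {A B : Set V} {ε : ℝ}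
    (h : TwoSidedBipartiteExpander G A B ε) : TwoSidedBipartiteExpander G B A ε :=
  ⟨h.1.symm, h.2.1.symm, h.2.2.2, h.2.2.1⟩

namespace Unraveling

theorem ncard_eq_sum_ncard_fiber {V V' : Type*} [Fintype V] {ι : V → Type*} [∀ v, Finite (ι v)]
    (f : (v : V) → ι v → V') (hf : Function.Bijective fun p : Σ v, ι v => f p.1 p.2)
    (S : Set V') : S.ncard = ∑ v, {i | f v i ∈ S}.ncard := by
  have e : (Σ v, {i : ι v // f v i ∈ S}) ≃ S :=
    Equiv.ofBijective (fun p => ⟨f p.1 p.2.1, p.2.2⟩) <| by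
      constructor
      · rintro ⟨v, i, hi⟩ ⟨w, j, hj⟩ h
        have h' := @hf.1 ⟨v, i⟩ ⟨w, j⟩ (congrArg Subtype.val h)
        cases h'
        rfl
      · rintro ⟨x, hx⟩
        obtain ⟨⟨v, i⟩, rfl⟩ := hf.2 x
        exact ⟨⟨v, i, hx⟩, rfl⟩
  rw [← Nat.card_coe_set_eq, ← Nat.card_congr e, Nat.card_sigma]
  rfl

section Cycle

variable {V' : Type*} {N : ℕ} {G' : SimpleGraph V'} {X Y S : Set V'} {f : ZMod N → V'}

theorem image_add_one_subset_nbhd (hc : ∀ i, G'.Adj (f i) (f (i + 1))) :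
    (· + 1) '' {i | f i ∈ S} ⊆ {i | f i ∈ Nbhd G' S} := by
  rintro _ ⟨i, hi, rfl⟩
  exact ⟨f i, hi, hc i⟩

theorem image_sub_one_subset_nbhd (hc : ∀ i, G'.Adj (f i) (f (i + 1))) :
    (· - 1) '' {i | f i ∈ S} ⊆ {i | f i ∈ Nbhd G' S} := by
  rintro _ ⟨i, hi, rfl⟩
  refine ⟨f i, hi, ?_⟩
  have h := (hc (i - 1)).symm
  rwa [sub_add_cancel] at h

variable [NeZero N]

/-- Every cycle of a bipartite graph meets the two sides equally often. -/
theorem ncard_cycle_side (hb : IsBipartition G' X Y) (hc : ∀ i, G'.Adj (f i) (f (i + 1))) :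
    2 * {i | f i ∈ X}.ncard = N := by
  have hXY : {i | f i ∈ Y} = (· + 1) '' {i | f i ∈ X} := by
    ext j
    constructor
    · intro hj
      have h := (hc (j - 1)).symm
      rw [sub_add_cancel] at h
      exact ⟨j - 1, hb.symm.mem_right h hj, sub_add_cancel _ _⟩
    · rintro ⟨i, hi, rfl⟩
      exact hb.mem_right (hc i) hi
  have hcard : {i | f i ∈ Y}.ncard = {i | f i ∈ X}.ncard := by
    rw [hXY, Set.ncard_image_of_injective _ (add_left_injective 1)]
  have hdisj : Disjoint {i | f i ∈ X} {i | f i ∈ Y} :=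
    Set.disjoint_left.2 fun i hi => Set.disjoint_left.1 hb.2.1 hi
  have huniv : {i | f i ∈ X} ∪ {i | f i ∈ Y} = Set.univ := by
    ext i
    simpa using (hb.1 ▸ Set.mem_univ (f i) : f i ∈ X ∪ Y)
  have h := Set.ncard_union_eq hdisj
  rw [huniv, Set.ncard_univ, Nat.card_zmod, hcard] at h
  omega

theorem ncard_le_ncard_nbhd_cycle (hc : ∀ i, G'.Adj (f i) (f (i + 1))) :
    {i | f i ∈ S}.ncard ≤ {i | f i ∈ Nbhd G' S}.ncard := by
  rw [← Set.ncard_image_of_injective {i | f i ∈ S} (add_left_injective 1)]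
  exact Set.ncard_le_ncard (image_add_one_subset_nbhd hc)

/-- A nonempty set of vertices on one side of a cycle which does not expand contains the
whole side. -/
theorem full_of_ncard_nbhd_cycle_le (hb : IsBipartition G' X Y)
    (hc : ∀ i, G'.Adj (f i) (f (i + 1))) (hS : S ⊆ X) (hne : {i | f i ∈ S}.Nonempty)
    (hle : {i | f i ∈ Nbhd G' S}.ncard ≤ {i | f i ∈ S}.ncard) {j : ZMod N} (hj : f j ∈ X) :
    f j ∈ S := by
  have hadd : (· + 1) '' {i | f i ∈ S} = {i | f i ∈ Nbhd G' S} :=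
    Set.eq_of_subset_of_ncard_le (image_add_one_subset_nbhd hc)
      (by rwa [Set.ncard_image_of_injective _ (add_left_injective 1)])
  have hsub : (· - 1) '' {i | f i ∈ S} = {i | f i ∈ Nbhd G' S} :=
    Set.eq_of_subset_of_ncard_le (image_sub_one_subset_nbhd hc)
      (by rwa [Set.ncard_image_of_injective _ sub_left_injective])
  have hstep : ∀ i, f i ∈ S → f (i + 2) ∈ S := by
    intro i hi
    have h : i + 1 ∈ (· - 1) '' {i | f i ∈ S} := by
      rw [hsub, ← hadd]
      exact ⟨i, hi, rfl⟩
    obtain ⟨l, hl, hli⟩ := h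
    have hl' : l = i + 2 := by
      have := eq_add_of_sub_eq hli
      rw [this]; ring
    exact hl' ▸ hl
  obtain ⟨i, hi⟩ := hne
  have heven : ∀ s : ℕ, f (i + 2 * s) ∈ S := by
    intro s
    induction s with
    | zero => simpa using hi
    | succ s ih =>
      have h := hstep _ ih
      rwa [show i + 2 * (s : ZMod N) + 2 = i + 2 * ((s + 1 : ℕ) : ZMod N) by push_cast; ring] at h
  have hval : j = i + ((j - i).val : ZMod N) := by
    rw [ZMod.natCast_zmod_val]; ring
  rcases Nat.even_or_odd' (j - i).val with ⟨s, hs | hs⟩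
  · rw [hval, hs]
    simpa using heven s
  · exfalso
    have hY : f (i + 2 * s + 1) ∈ Y := hb.mem_right (hc _) (hS (heven s))
    rw [hs] at hval
    push_cast at hval
    rw [add_assoc, ← hval] at hY
    exact Set.disjoint_left.1 hb.2.1 hj hY

end Cycle

/-- The arithmetic behind `le_ncard_mul_of_boundary_subset`, with the two factors of the
expansion constant cleared of denominators. -/
theorem mul_le_of_side_bounds {ε d k n a b p q x y w s : ℝ} (hε0 : 0 < ε) (hε1 : ε ≤ 1)
    (hd : 2 ≤ d) (hk : 0 < k) (hx : 0 ≤ x) (hy : 0 ≤ y) (hn : 0 < n)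
    (hp : p ≤ x + b) (hq : q ≤ y + a) (hw : x + y ≤ w)
    (ha1 : a ≤ n / 2 → (1 + ε) * a ≤ p) (ha2 : n / 2 < a → ε * n + a ≤ (1 + ε) * p)
    (hb1 : b ≤ n / 2 → (1 + ε) * b ≤ q) (hb2 : n / 2 < b → ε * n + b ≤ (1 + ε) * q)
    (hs1 : s ≤ (1 + ε / 4) * k * (a + b + w)) (hs2 : k * (a + b) ≤ s)
    (hs3 : s ≤ (1 + ε / 4) * k * n) :
    ε * s ≤ w * (k * (ε + d * (1 + ε))) := by
  have hw0 : 0 ≤ w := by linarith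
  have hfac : w * (k * (ε + 2 * (1 + ε))) ≤ w * (k * (ε + d * (1 + ε))) := by gcongr
  refine le_trans ?_ hfac
  have large : ε * n ≤ 2 * (1 + ε) * w → ε * s ≤ w * (k * (ε + 2 * (1 + ε))) := by
    intro h
    have h1 : ε * s ≤ (1 + ε / 4) * k * (ε * n) := by nlinarith
    have h2 : (1 + ε / 4) * k * (ε * n) ≤ (1 + ε / 4) * k * (2 * (1 + ε) * w) := by gcongr
    have h3 : 0 ≤ w * k * (ε * (1 - ε)) := by
      have := sub_nonneg.2 hε1
      positivity
    nlinarith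
  by_cases ha : a ≤ n / 2 <;> by_cases hb : b ≤ n / 2
  · have h1 : ε * (a + b) ≤ w := by linarith [ha1 ha, hb1 hb]
    have h2 : ε * s ≤ (1 + ε / 4) * k * (ε * (a + b) + ε * w) := by nlinarith
    have h3 : (1 + ε / 4) * k * (ε * (a + b) + ε * w) ≤ (1 + ε / 4) * k * (w + ε * w) := by
      gcongr
    have h4 : 0 ≤ w * k * (1 + ε) * (1 - ε / 4) := by
      have : 0 ≤ 1 - ε / 4 := by linarith
      positivity
    have h5 : 0 ≤ w * k * ε := by positivity
    nlinarith
  · apply large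
    push Not at hb
    have := hb2 hb
    have hqw : q ≤ w + n / 2 := by linarith
    nlinarith
  · apply large
    push Not at ha
    have := ha2 ha
    have hpw : p ≤ w + n / 2 := by linarith
    nlinarith
  · apply large
    push Not at ha hb
    have h1 : a + b ≤ (1 + ε / 4) * n := by
      have : k * (a + b) ≤ k * ((1 + ε / 4) * n) := by linarith
      exact le_of_mul_le_mul_left this hk
    have h2 := ha2 ha
    have h3 := hb2 hb
    have h4 : (1 + ε) * (p + q) ≤ (1 + ε) * (w + (a + b)) :=
      mul_le_mul_of_nonneg_left (by linarith) (by linarith)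
    have h5 : ε * (a + b) ≤ ε * ((1 + ε / 4) * n) := by gcongr
    have h6 : 0 ≤ ε * n * (1 - ε) := by
      have := sub_nonneg.2 hε1
      positivity
    nlinarith [mul_pos hε0 hn]

section Expander

variable {V : Type*} {G : SimpleGraph V} {A B : Set V} {ε : ℝ}

theorem two_le_of_expander (hε : 0 < ε) {Δ : ℕ} (hΔ : ∀ v, (G.neighborSet v).ncard ≤ Δ)
    (hG : TwoSidedBipartiteExpander G A B ε) (hn : 2 ≤ A.ncard) : 2 ≤ Δ := by
  obtain ⟨a, ha⟩ := Set.nonempty_of_ncard_ne_zero (show A.ncard ≠ 0 by omega)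
  have h := hG.2.2.1 {a} (Set.singleton_subset_iff.2 ha) (by
    rw [Set.ncard_singleton]
    have : (2 : ℝ) ≤ A.ncard := by exact_mod_cast hn
    push_cast
    linarith)
  have hN : Nbhd G {a} = G.neighborSet a := by
    ext y
    simp [Nbhd]
  rw [hN, Set.ncard_singleton] at h
  have h1 : (1 : ℝ) < (G.neighborSet a).ncard := by
    push_cast at h
    linarith
  have h2 : 1 < (G.neighborSet a).ncard := by exact_mod_cast h1
  exact h2.trans_le (hΔ a)

variable [Finite V]

theorem le_ncard_nbhd_of_half_lt (hε : 0 < ε) (hG : TwoSidedBipartiteExpander G A B ε)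
    (hn : 2 ≤ A.ncard) {F : Set V} (hF : F ⊆ A) (hlarge : (A.ncard : ℝ) / 2 < F.ncard) :
    ε * A.ncard + F.ncard ≤ (1 + ε) * (Nbhd G F).ncard := by
  have hlarge' : A.ncard < 2 * F.ncard := by
    have : (A.ncard : ℝ) < 2 * F.ncard := by linarith
    exact_mod_cast this
  obtain ⟨F₀, hF₀, hcard⟩ := Set.exists_subset_card_eq (s := F) (n := A.ncard / 2) (by omega)
  have hexp := hG.2.2.1 F₀ (hF₀.trans hF) (by rw [hcard]; exact_mod_cast Nat.cast_div_le)
  have hmono : (Nbhd G F₀).ncard ≤ (Nbhd G F).ncard :=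
    Set.ncard_le_ncard fun y ⟨x, hx, hxy⟩ => ⟨x, hF₀ hx, hxy⟩
  have hlt : A.ncard / 2 < (Nbhd G F).ncard := by
    have hpos : (0 : ℝ) < F₀.ncard := by
      rw [hcard]
      exact_mod_cast (show 0 < A.ncard / 2 by omega)
    have : (F₀.ncard : ℝ) < (Nbhd G F₀).ncard := by nlinarith
    have : F₀.ncard < (Nbhd G F₀).ncard := by exact_mod_cast this
    omega
  have hNB := hG.1.nbhd_subset hF
  have hT : (B \ Nbhd G F).ncard + (Nbhd G F).ncard = A.ncard := by
    rw [Set.ncard_sdiff_add_ncard_of_subset hNB, hG.2.1]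
  have hexpT := hG.2.2.2 (B \ Nbhd G F) Set.sdiff_subset (by
    rw [← hG.2.1]
    have h : 2 * (B \ Nbhd G F).ncard ≤ A.ncard := by omega
    have : (2 : ℝ) * (B \ Nbhd G F).ncard ≤ A.ncard := by exact_mod_cast h
    linarith)
  have hNT : Nbhd G (B \ Nbhd G F) ⊆ A \ F := by
    rintro x ⟨y, hy, hyx⟩
    exact ⟨hG.1.symm.mem_right hyx hy.1, fun hx => hy.2 ⟨x, hx, hyx.symm⟩⟩
  have h1 : ((Nbhd G (B \ Nbhd G F)).ncard : ℝ) ≤ (A \ F).ncard := by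
    exact_mod_cast Set.ncard_le_ncard hNT
  have h2 : ((A \ F).ncard : ℝ) + F.ncard = A.ncard := by
    exact_mod_cast Set.ncard_sdiff_add_ncard_of_subset hF
  have h3 : ((B \ Nbhd G F).ncard : ℝ) + (Nbhd G F).ncard = A.ncard := by exact_mod_cast hT
  have h4 : ((B \ Nbhd G F).ncard : ℝ) = A.ncard - (Nbhd G F).ncard := by linarith
  rw [h4] at hexpT
  linarith

/-- If `F` is a set of vertices whose external boundary is contained in `W`, a weight `s`
comparable to `k |F|` and bounded by about half the total weight is controlled by `|W|`. -/
theorem le_ncard_mul_of_boundary_subset (hε0 : 0 < ε) (hε1 : ε ≤ 1) {Δ : ℕ} (hΔ : 2 ≤ Δ)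
    (hG : TwoSidedBipartiteExpander G A B ε) (hn : 2 ≤ A.ncard) {k s : ℝ} (hk : 0 < k)
    {F W : Set V} (hFW : Nbhd G F \ F ⊆ W)
    (hs1 : s ≤ (1 + ε / 4) * k * (F.ncard + W.ncard)) (hs2 : k * F.ncard ≤ s)
    (hs3 : s ≤ (1 + ε / 4) * k * A.ncard) :
    ε * s ≤ W.ncard * (k * (ε + Δ * (1 + ε))) := by
  have hF : (F.ncard : ℝ) = (F ∩ A).ncard + (F ∩ B).ncard := by
    exact_mod_cast (hG.1.ncard_add_ncard F).symm
  have hsideA := hG.1.nbhd_subset (Set.inter_subset_right (s := F))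
  have hsideB := hG.1.symm.nbhd_subset
    (Set.inter_subset_right (s := F))
  have hp : (Nbhd G (F ∩ A)).ncard ≤ (Nbhd G (F ∩ A) \ (F ∩ B)).ncard + (F ∩ B).ncard :=
    Set.ncard_le_ncard_sdiff_add_ncard _ _
  have hq : (Nbhd G (F ∩ B)).ncard ≤ (Nbhd G (F ∩ B) \ (F ∩ A)).ncard + (F ∩ A).ncard :=
    Set.ncard_le_ncard_sdiff_add_ncard _ _
  have hw : (Nbhd G (F ∩ A) \ (F ∩ B)).ncard + (Nbhd G (F ∩ B) \ (F ∩ A)).ncard ≤ W.ncard := by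
    rw [← Set.ncard_union_eq]
    · refine Set.ncard_le_ncard ?_
      rintro y (⟨hy, hyF⟩ | ⟨hy, hyF⟩)
      · have hyB := hsideA hy
        obtain ⟨x, hx, hxy⟩ := hy
        exact hFW ⟨⟨x, hx.1, hxy⟩, fun h => hyF ⟨h, hyB⟩⟩
      · have hyA := hsideB hy
        obtain ⟨x, hx, hxy⟩ := hy
        exact hFW ⟨⟨x, hx.1, hxy⟩, fun h => hyF ⟨h, hyA⟩⟩
    · exact (hG.1.2.1.mono (Set.sdiff_subset.trans hsideB) (Set.sdiff_subset.trans hsideA)).symm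
  have hBA : (B.ncard : ℝ) = A.ncard := by rw [hG.2.1]
  refine mul_le_of_side_bounds (a := (F ∩ A).ncard) (b := (F ∩ B).ncard) (n := A.ncard)
    (p := (Nbhd G (F ∩ A)).ncard) (q := (Nbhd G (F ∩ B)).ncard)
    (x := (Nbhd G (F ∩ A) \ (F ∩ B)).ncard) (y := (Nbhd G (F ∩ B) \ (F ∩ A)).ncard)
    hε0 hε1 (by exact_mod_cast hΔ) hk (by positivity) (by positivity) ?_ (by exact_mod_cast hp)
    (by exact_mod_cast hq) (by exact_mod_cast hw) ?_ ?_ ?_ ?_ (by rwa [← hF]) (by rwa [← hF]) hs3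
  · exact_mod_cast (show 0 < A.ncard by omega)
  · exact hG.2.2.1 _ Set.inter_subset_right
  · exact le_ncard_nbhd_of_half_lt hε0 hG hn Set.inter_subset_right
  · rw [← hBA]
    exact hG.2.2.2 _ Set.inter_subset_right
  · rw [← hBA]
    exact le_ncard_nbhd_of_half_lt hε0 hG.symm (hG.2.1 ▸ hn)
      Set.inter_subset_right

end Expander

section Unravel

variable {V V' : Type*} [Fintype V] {G : SimpleGraph V} {G' : SimpleGraph V'}
  {X Y S : Set V'} {kv : V → ℕ} [∀ v, NeZero (2 * kv v)] {f : (v : V) → ZMod (2 * kv v) → V'}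

theorem ncard_side (hb : IsBipartition G' X Y) (hc : ∀ v i, G'.Adj (f v i) (f v (i + 1)))
    (hf : Function.Bijective fun p : Σ v, ZMod (2 * kv v) => f p.1 p.2) :
    X.ncard = ∑ v, kv v := by
  rw [ncard_eq_sum_ncard_fiber f hf]
  refine Finset.sum_congr rfl fun v _ => ?_
  have := ncard_cycle_side hb (hc v)
  omega

open Classical in
/-- Each cycle that `S` meets partially, and each cycle that `S` misses but which is adjacent
to a cycle filled by `S`, contributes one more vertex to `N(S)` than to `S`. -/
theorem ncard_add_ncard_le_ncard_nbhd (hb : IsBipartition G' X Y)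
    (hc : ∀ v i, G'.Adj (f v i) (f v (i + 1)))
    (hf : Function.Bijective fun p : Σ v, ZMod (2 * kv v) => f p.1 p.2)
    (hedges : ∀ v w, G.Adj v w →
      ∃ x y, G'.Adj x y ∧ x ∈ Set.range (f v) ∩ X ∧ y ∈ Set.range (f w) ∩ Y)
    (hS : S ⊆ X) {F : Set V} (hF : F = {v | ∀ i, f v i ∈ X → f v i ∈ S}) :
    S.ncard + {v | v ∉ F ∧ ((∃ i, f v i ∈ S) ∨ v ∈ Nbhd G F)}.ncard ≤ (Nbhd G' S).ncard := by
  rw [ncard_eq_sum_ncard_fiber f hf S, ncard_eq_sum_ncard_fiber f hf (Nbhd G' S),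
    Set.ncard_eq_toFinset_card', Set.toFinset_ofPred, Finset.card_filter, ← Finset.sum_add_distrib]
  refine Finset.sum_le_sum fun v _ => ?_
  split_ifs with hv
  · obtain ⟨hvF, hv⟩ := hv
    by_cases hne : {i | f v i ∈ S}.Nonempty
    · by_contra hlt
      refine hvF ?_
      rw [hF]
      intro i
      exact full_of_ncard_nbhd_cycle_le hb (hc v) hS hne (by omega)
    · obtain ⟨w, hw, hwv⟩ := hv.resolve_left hne
      obtain ⟨x, y, hxy, ⟨⟨i, rfl⟩, hi⟩, ⟨j, rfl⟩, -⟩ := hedges w v hwv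
      rw [hF] at hw
      rw [Set.not_nonempty_iff_eq_empty.1 hne, Set.ncard_empty, zero_add]
      exact (Set.ncard_pos).2 ⟨j, f w i, hw i hi, hxy⟩
  · exact ncard_le_ncard_nbhd_cycle (hc v)

end Unravel

theorem expansion_of_unraveling {V V' : Type*} [Fintype V] [Finite V']
    {G : SimpleGraph V} {A B : Set V} {ε : ℝ} (hε0 : 0 < ε) (hε1 : ε ≤ 1)
    {Δ : ℕ} (hΔ : 2 ≤ Δ) (hG : TwoSidedBipartiteExpander G A B ε) (hn : 2 ≤ A.ncard)
    {k : ℕ} (hk : 0 < k) {kv : V → ℕ} [∀ v, NeZero (2 * kv v)] (hkv1 : ∀ v, k ≤ kv v)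
    (hkv2 : ∀ v, (kv v : ℝ) ≤ (1 + ε / 4) * (k : ℝ))
    {G' : SimpleGraph V'} {X Y : Set V'} (hb : IsBipartition G' X Y)
    {f : (v : V) → ZMod (2 * kv v) → V'} (hc : ∀ v i, G'.Adj (f v i) (f v (i + 1)))
    (hf : Function.Bijective fun p : Σ v, ZMod (2 * kv v) => f p.1 p.2)
    (hedges : ∀ v w, G.Adj v w →
      ∃ x y, G'.Adj x y ∧ x ∈ Set.range (f v) ∩ X ∧ y ∈ Set.range (f w) ∩ Y)
    {S : Set V'} (hS : S ⊆ X) (hhalf : (S.ncard : ℝ) ≤ (X.ncard : ℝ) / 2) :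
    (1 + ((k : ℝ) + (k : ℝ) * (Δ : ℝ) * ((1 + ε) / ε))⁻¹) * (S.ncard : ℝ) ≤
      ((Nbhd G' S).ncard : ℝ) := by
  classical
  set F : Set V := {v | ∀ i, f v i ∈ X → f v i ∈ S} with hF
  set W : Set V := {v | v ∉ F ∧ ((∃ i, f v i ∈ S) ∨ v ∈ Nbhd G F)} with hW
  have hmain := ncard_add_ncard_le_ncard_nbhd hb hc hf hedges hS hF
  have hkR : (0 : ℝ) < k := by exact_mod_cast hk
  have hside : ∀ v, {i | f v i ∈ X}.ncard = kv v := fun v => by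
    have := ncard_cycle_side hb (hc v)
    omega
  have hcardV : Fintype.card V = A.ncard + A.ncard := by
    have h := hG.1.ncard_add_ncard Set.univ
    rw [Set.univ_inter, Set.univ_inter, ← hG.2.1, Set.ncard_univ, Nat.card_eq_fintype_card] at h
    exact h.symm
  have hs1 : (S.ncard : ℝ) ≤ (1 + ε / 4) * k * (F.ncard + W.ncard) := by
    have hle : S.ncard ≤ ∑ v ∈ (F ∪ W).toFinset, kv v := by
      rw [ncard_eq_sum_ncard_fiber f hf S]
      rw [← Finset.sum_subset (Finset.subset_univ (F ∪ W).toFinset)]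
      · exact Finset.sum_le_sum fun v _ =>
          (Set.ncard_le_ncard
          (show {i | f v i ∈ S} ⊆ {i | f v i ∈ X} from fun i hi => hS hi)).trans_eq (hside v)
      · intro v _ hv
        rw [Set.ncard_eq_zero, Set.eq_empty_iff_forall_notMem]
        intro i hi
        apply hv
        rw [Set.mem_toFinset]
        by_cases hvF : v ∈ F
        · exact Or.inl hvF
        · exact Or.inr ⟨hvF, Or.inl ⟨i, hi⟩⟩
    calc (S.ncard : ℝ) ≤ ∑ v ∈ (F ∪ W).toFinset, (kv v : ℝ) := by exact_mod_cast hle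
      _ ≤ (F ∪ W).toFinset.card • ((1 + ε / 4) * (k : ℝ)) :=
        Finset.sum_le_card_nsmul _ _ _ fun v _ => hkv2 v
      _ = (1 + ε / 4) * k * ((F ∪ W).ncard : ℝ) := by
        rw [nsmul_eq_mul, ← Set.ncard_eq_toFinset_card', mul_comm]
      _ ≤ _ := by
        gcongr
        exact_mod_cast Set.ncard_union_le F W
  have hs2 : (k : ℝ) * F.ncard ≤ S.ncard := by
    have hle : F.ncard * k ≤ S.ncard := by
      rw [ncard_eq_sum_ncard_fiber f hf S, Set.ncard_eq_toFinset_card', ← smul_eq_mul]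
      refine (Finset.card_nsmul_le_sum F.toFinset (fun v => {i | f v i ∈ S}.ncard) k ?_).trans
        (Finset.sum_le_sum_of_subset (Finset.subset_univ _))
      intro v hv
      rw [Set.mem_toFinset] at hv
      have hsub : {i | f v i ∈ X} ⊆ {i | f v i ∈ S} := fun i hi => hv i hi
      exact (hkv1 v).trans ((hside v).symm.trans_le (Set.ncard_le_ncard hsub))
    rw [mul_comm]
    exact_mod_cast hle
  have hs3 : (S.ncard : ℝ) ≤ (1 + ε / 4) * k * A.ncard := by
    have hX : (X.ncard : ℝ) ≤ (A.ncard + A.ncard) * ((1 + ε / 4) * k) := by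
      rw [ncard_side hb hc hf]
      push_cast
      calc ∑ v, (kv v : ℝ) ≤ Fintype.card V • ((1 + ε / 4) * (k : ℝ)) :=
            Finset.sum_le_card_nsmul _ _ _ fun v _ => hkv2 v
        _ = _ := by rw [hcardV, nsmul_eq_mul]; push_cast; rfl
    linarith
  have hbound := le_ncard_mul_of_boundary_subset hε0 hε1 hΔ hG hn hkR (F := F) (W := W)
    (fun v hv => ⟨hv.2, Or.inr hv.1⟩) hs1 hs2 hs3
  have hmainR : (S.ncard : ℝ) + W.ncard ≤ (Nbhd G' S).ncard := by exact_mod_cast hmain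
  set c : ℝ := (k : ℝ) + (k : ℝ) * (Δ : ℝ) * ((1 + ε) / ε) with hcdef
  have hcpos : 0 < c := by positivity
  have hc' : ε * c = k * (ε + Δ * (1 + ε)) := by
    rw [hcdef]
    field_simp
  have h : (S.ncard : ℝ) ≤ c * W.ncard := by
    refine le_of_mul_le_mul_left ?_ hε0
    rw [← mul_assoc, hc', mul_comm _ (W.ncard : ℝ)]
    exact hbound
  have h' : c⁻¹ * (S.ncard : ℝ) ≤ W.ncard := (inv_mul_le_iff₀ hcpos).2 h
  linarith

end Unraveling

/-- Generalised unraveling lemma.  Let `G` be a two-sided bipartite `ε`-expander with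
bipartition `(A,B)`, maximum degree `Δ` and `n := |A| = |B| ≥ 3`.  Let `k ≥ 2` and for
each vertex `v` let `k ≤ k_v ≤ (1+ε/4)k`.  Let `G'` be a bipartite graph with
bipartition `(X,Y)` containing pairwise disjoint cycles `C_v` (here given by injective
maps `f v : ZMod (2 k_v) → V'` with consecutive images adjacent) with `|C_v| = 2 k_v`,
whose vertex sets cover `V(G')`, such that for each edge `vw` of `G` there are edges
`xy` and `pq` of `G'` with `x ∈ C_v ∩ X`, `y ∈ C_w ∩ Y`, `p ∈ C_v ∩ Y`, `q ∈ C_w ∩ X`.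
Then `G'` is a two-sided bipartite `ε'`-expander with `ε' = (k + kΔ(1+ε)/ε)⁻¹`. -/
theorem stmt3 {V V' : Type*} [Fintype V] [Fintype V']
    (G : SimpleGraph V) (A B : Set V) (ε : ℝ) (hε0 : 0 < ε) (hε1 : ε ≤ 1)
    (Δ : ℕ) (hΔ : ∀ v, (G.neighborSet v).ncard ≤ Δ)
    (hG : TwoSidedBipartiteExpander G A B ε)
    (hn : 3 ≤ A.ncard)
    (k : ℕ) (hk : 2 ≤ k)
    (kv : V → ℕ) (hkv1 : ∀ v, k ≤ kv v)
    (hkv2 : ∀ v, (kv v : ℝ) ≤ (1 + ε / 4) * (k : ℝ))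
    (G' : SimpleGraph V') (X Y : Set V')
    (hbip : IsBipartition G' X Y)
    (f : (v : V) → ZMod (2 * kv v) → V')
    (hinj : ∀ v, Function.Injective (f v))
    (hcyc : ∀ v i, G'.Adj (f v i) (f v (i + 1)))
    (hdisjcyc : ∀ v w, v ≠ w → Disjoint (Set.range (f v)) (Set.range (f w)))
    (hcover : ∀ x : V', ∃ v i, f v i = x)
    (hedges : ∀ v w, G.Adj v w →
      (∃ x y, G'.Adj x y ∧ x ∈ Set.range (f v) ∩ X ∧ y ∈ Set.range (f w) ∩ Y) ∧
      (∃ p q, G'.Adj p q ∧ p ∈ Set.range (f v) ∩ Y ∧ q ∈ Set.range (f w) ∩ X)) :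
    TwoSidedBipartiteExpander G' X Y
      (((k : ℝ) + (k : ℝ) * (Δ : ℝ) * ((1 + ε) / ε))⁻¹) := by
  have hpos : ∀ v, NeZero (2 * kv v) := fun v => ⟨by have := hkv1 v; omega⟩
  have hf : Function.Bijective fun p : Σ v, ZMod (2 * kv v) => f p.1 p.2 := by
    constructor
    · rintro ⟨v, i⟩ ⟨w, j⟩ h
      dsimp only at h
      obtain rfl : v = w := by
        by_contra hvw
        exact Set.disjoint_left.1 (hdisjcyc v w hvw) ⟨i, rfl⟩ ⟨j, h.symm⟩
      rw [hinj v h]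
    · intro x
      obtain ⟨v, i, h⟩ := hcover x
      exact ⟨⟨v, i⟩, h⟩
  have hΔ2 := Unraveling.two_le_of_expander hε0 hΔ hG (by omega)
  refine ⟨hbip, ?_, fun S hS hhalf => ?_, fun T hT hhalf => ?_⟩
  · rw [Unraveling.ncard_side hbip hcyc hf, Unraveling.ncard_side hbip.symm hcyc hf]
  · exact Unraveling.expansion_of_unraveling hε0 hε1 hΔ2 hG (by omega) (by omega) hkv1 hkv2
      hbip hcyc hf (fun v w h => (hedges v w h).1) hS hhalf
  · exact Unraveling.expansion_of_unraveling hε0 hε1 hΔ2 hG (by omega) (by omega) hkv1 hkv2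
      hbip.symm hcyc hf (fun v w h => (hedges v w h).2) hT hhalf
end

section
/- Let I be an independent set in a cycle graph C. Then |N_C(I)| ≥ |I|, with equality only if I = ∅ or |V(C)| = 2|I|. -/
namespace SimpleGraph

variable {V : Type*} {G : SimpleGraph V}

/-- Double counting of the edges between `S` and a set `T` containing all its neighbours. -/
theorem IsRegularOfDegree.sum_card_neighborFinset_inter [Fintype V] [DecidableEq V]
    [DecidableRel G.Adj] {d : ℕ} (h : G.IsRegularOfDegree d) {S T : Finset V}
    (hT : ∀ x ∈ S, G.neighborFinset x ⊆ T) :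
    ∑ y ∈ T, (G.neighborFinset y ∩ S).card = S.card * d := by
  have key := Finset.sum_card_bipartiteAbove_eq_sum_card_bipartiteBelow (s := S) (t := T) G.Adj
  have habove : ∀ x ∈ S, (T.bipartiteAbove G.Adj x).card = d := fun x hx => by
    rw [← h x, ← G.card_neighborFinset_eq_degree x]
    congr 1
    ext y
    simpa [Finset.bipartiteAbove] using fun hxy => hT x hx (by simpa using hxy)
  rw [Finset.sum_congr rfl habove, Finset.sum_const, smul_eq_mul] at key
  rw [key]
  refine Finset.sum_congr rfl fun y _ => congrArg Finset.card ?_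
  ext x
  simp [Finset.bipartiteBelow, G.adj_comm, and_comm]

/-- In a connected graph, a nonempty set of vertices closed under adjacency is everything. -/
theorem Connected.eq_univ_of_adj_closed (h : G.Connected) {S : Set V} (hS : S.Nonempty)
    (hclosed : ∀ x ∈ S, ∀ y, G.Adj x y → y ∈ S) : S = Set.univ := by
  obtain ⟨x, hx⟩ := hS
  refine Set.eq_univ_of_forall fun y => ?_
  obtain ⟨p⟩ := h.preconnected x y
  induction p with
  | nil => exact hx
  | cons hadj _ ih => exact ih (hclosed _ hx _ hadj)

end SimpleGraph

/-- Let `I` be an independent set in a cycle graph `C` (a finite connected 2-regular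
graph).  Then `|N_C(I)| ≥ |I|`, with equality only if `I = ∅` or `|V(C)| = 2|I|`. -/
theorem stmt4 {V : Type*} [Fintype V] (C : SimpleGraph V)
    (hconn : C.Connected) (hreg : ∀ v, (C.neighborSet v).ncard = 2)
    (I : Set V) (hI : ∀ x ∈ I, ∀ y ∈ I, ¬C.Adj x y) :
    I.ncard ≤ (Nbhd C I).ncard ∧
    ((Nbhd C I).ncard = I.ncard → I = ∅ ∨ Fintype.card V = 2 * I.ncard) := by
  classical
  have hdeg : C.IsRegularOfDegree 2 := fun v => by
    rw [← hreg v, ← C.card_neighborSet_eq_degree, ← Nat.card_eq_fintype_card, Nat.card_coe_set_eq]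
  have hsum := hdeg.sum_card_neighborFinset_inter (S := I.toFinset) (T := (Nbhd C I).toFinset)
    fun x hx y hy => by
      simp only [Set.mem_toFinset, SimpleGraph.mem_neighborFinset] at hx hy ⊢
      exact ⟨x, hx, hy⟩
  have hle : ∀ y ∈ (Nbhd C I).toFinset, (C.neighborFinset y ∩ I.toFinset).card ≤ 2 := fun y _ =>
    (Finset.card_le_card Finset.inter_subset_left).trans
      (C.card_neighborFinset_eq_degree y ▸ (hdeg y).le)
  have hsum_le := Finset.sum_le_sum hle
  rw [hsum, Finset.sum_const, smul_eq_mul] at hsum_le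
  rw [Set.ncard_eq_toFinset_card' I, Set.ncard_eq_toFinset_card' (Nbhd C I)]
  refine ⟨by omega, fun heq => or_iff_not_imp_left.2 fun hne => ?_⟩
  have hcard := (Finset.sum_eq_sum_iff_of_le hle).1 (by simp [hsum, heq])
  have hback : ∀ y ∈ Nbhd C I, ∀ z, C.Adj y z → z ∈ I := fun y hy z hyz => by
    have hinter := Finset.eq_of_subset_of_card_le
      (Finset.inter_subset_left (s₁ := C.neighborFinset y) (s₂ := I.toFinset))
      (by rw [hcard y (Set.mem_toFinset.2 hy), C.card_neighborFinset_eq_degree, hdeg y])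
    exact Set.mem_toFinset.1 (Finset.inter_eq_left.1 hinter ((C.mem_neighborFinset y z).2 hyz))
  have huniv : I ∪ Nbhd C I = Set.univ :=
    hconn.eq_univ_of_adj_closed ((Set.nonempty_iff_ne_empty.2 hne).inl) fun x hx y hxy =>
      hx.elim (fun hx => Or.inr ⟨x, hx, hxy⟩) (fun hx => Or.inl (hback x hx y hxy))
  have hdisj : Disjoint I.toFinset (Nbhd C I).toFinset :=
    Set.disjoint_toFinset.2 <| Set.disjoint_left.2 fun y hy ⟨x, hx, hxy⟩ => hI x hx y hy hxy
  have hunion : I.toFinset ∪ (Nbhd C I).toFinset = Finset.univ := by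
    rw [← Set.toFinset_union, Set.toFinset_eq_univ, huniv]
  rw [← Finset.card_univ, ← hunion, Finset.card_union_of_disjoint hdisj, heq, two_mul]
end

section
/- The wall W is 3-monotone bipartite. Explicitly, with colour classes A = { (x,y) ∈ ℤ² : x + y even } and B = { (x,y) ∈ ℤ² : x + y odd }, each totally ordered by the diagonal order ⪯, the edge set of W is the union of three monotone matchings: for each (x,y) with x + y even, the red matching contains the edge (x,y)(x+1,y), the blue matching contains the edge (x,y)(x−1,y), and the green matching contains the edge (x,y)(x,y+1). -/
/-- Base relation of the wall: `(x,y)` is joined to `(x+1,y)` for all `x,y ∈ ℤ`, and to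
`(x,y+1)` whenever `x+y` is even. -/
def WallRel (p q : ℤ × ℤ) : Prop :=
  q = (p.1 + 1, p.2) ∨ (Even (p.1 + p.2) ∧ q = (p.1, p.2 + 1))

/-- The wall: the infinite graph on `ℤ²` generated by `WallRel`. -/
def Wall : SimpleGraph (ℤ × ℤ) := SimpleGraph.fromRel WallRel

/-- The (strict) diagonal order on `ℤ²`: `p ≺ q` iff `p.1+p.2 < q.1+q.2`, or
`p.1+p.2 = q.1+q.2` and `p.1 < q.1`. -/
def DiagLT (p q : ℤ × ℤ) : Prop :=
  p.1 + p.2 < q.1 + q.2 ∨ (p.1 + p.2 = q.1 + q.2 ∧ p.1 < q.1)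

/-- The red matching: edges `(x,y)(x+1,y)` for `x+y` even, oriented with the
`A`-endpoint (the one with even coordinate sum) first. -/
def RedM : Set ((ℤ × ℤ) × (ℤ × ℤ)) :=
  {e | Even (e.1.1 + e.1.2) ∧ e.2 = (e.1.1 + 1, e.1.2)}

/-- The blue matching: edges `(x,y)(x−1,y)` for `x+y` even. -/
def BlueM : Set ((ℤ × ℤ) × (ℤ × ℤ)) :=
  {e | Even (e.1.1 + e.1.2) ∧ e.2 = (e.1.1 - 1, e.1.2)}

/-- The green matching: edges `(x,y)(x,y+1)` for `x+y` even. -/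
def GreenM : Set ((ℤ × ℤ) × (ℤ × ℤ)) :=
  {e | Even (e.1.1 + e.1.2) ∧ e.2 = (e.1.1, e.1.2 + 1)}

/-- A monotone matching between the colour classes `A = {x+y even}` and
`B = {x+y odd}`, each ordered by the diagonal order: a matching no two of whose
edges cross. -/
def MonoMatchWall (M : Set ((ℤ × ℤ) × (ℤ × ℤ))) : Prop :=
  (∀ e ∈ M, ∀ f ∈ M, e ≠ f → e.1 ≠ f.1 ∧ e.2 ≠ f.2) ∧
  (∀ e ∈ M, ∀ f ∈ M, ¬(DiagLT e.1 f.1 ∧ DiagLT f.2 e.2))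

/-- A set of edges that all translate by the same vector is a monotone matching, since the
diagonal order is translation invariant. -/
theorem monoMatchWall_of_translation {M : Set ((ℤ × ℤ) × (ℤ × ℤ))} (v : ℤ × ℤ)
    (hM : ∀ e ∈ M, e.2 = e.1 + v) : MonoMatchWall M := by
  refine ⟨fun e he f hf hne => ?_, fun e he f hf => ?_⟩
  · have key : e.1 ≠ f.1 := fun h => hne (Prod.ext h (by rw [hM e he, hM f hf, h]))
    exact ⟨key, by rwa [hM e he, hM f hf, Ne, add_left_inj]⟩
  · rw [hM e he, hM f hf]
    simp only [DiagLT, Prod.fst_add, Prod.snd_add]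
    omega

/-- The wall is 3-monotone bipartite: with colour classes `A = {(x,y) : x+y even}` and
`B = {(x,y) : x+y odd}` ordered by the diagonal order, every edge of the wall is a red,
blue or green edge (each joining `A` to `B`), and each of the red, blue and green sets
is a monotone matching. -/
theorem stmt5 :
    (∀ e ∈ RedM ∪ BlueM ∪ GreenM, Even (e.1.1 + e.1.2) ∧ ¬Even (e.2.1 + e.2.2)) ∧
    (∀ p q : ℤ × ℤ, Wall.Adj p q ↔
      ((p, q) ∈ RedM ∪ BlueM ∪ GreenM ∨ (q, p) ∈ RedM ∪ BlueM ∪ GreenM)) ∧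
    MonoMatchWall RedM ∧ MonoMatchWall BlueM ∧ MonoMatchWall GreenM := by
  refine ⟨?_, ?_, monoMatchWall_of_translation (1, 0) ?_,
    monoMatchWall_of_translation (-1, 0) ?_, monoMatchWall_of_translation (0, 1) ?_⟩
  · rintro ⟨⟨a, b⟩, c, d⟩ h
    simp only [RedM, BlueM, GreenM, Set.mem_union, Set.mem_ofPred_eq, Prod.mk.injEq,
      Int.even_iff] at h ⊢
    omega
  · rintro ⟨a, b⟩ ⟨c, d⟩
    simp only [Wall, SimpleGraph.fromRel_adj, WallRel, RedM, BlueM, GreenM, Set.mem_union,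
      Set.mem_ofPred_eq, Prod.mk.injEq, Int.even_iff, ne_eq]
    constructor
    · rintro ⟨-, (⟨rfl, rfl⟩ | ⟨h, rfl, rfl⟩) | ⟨rfl, rfl⟩ | ⟨h, rfl, rfl⟩⟩
      · rcases Int.emod_two_eq_zero_or_one (a + d) with h | h
        · exact .inl (.inl (.inl ⟨h, rfl, rfl⟩))
        · exact .inr (.inl (.inr ⟨by omega, by omega, rfl⟩))
      · exact .inl (.inr ⟨h, rfl, rfl⟩)
      · rcases Int.emod_two_eq_zero_or_one (c + b) with h | h
        · exact .inr (.inl (.inl ⟨h, rfl, rfl⟩))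
        · exact .inl (.inl (.inr ⟨by omega, by omega, rfl⟩))
      · exact .inr (.inr ⟨h, rfl, rfl⟩)
    · rintro (((⟨h, rfl, rfl⟩ | ⟨h, rfl, rfl⟩) | ⟨h, rfl, rfl⟩) |
        ((⟨h, rfl, rfl⟩ | ⟨h, rfl, rfl⟩) | ⟨h, rfl, rfl⟩)) <;>
        simp [h, eq_sub_iff_add_eq]
  all_goals
    rintro ⟨⟨a, b⟩, c, d⟩ ⟨-, h⟩
    simpa [sub_eq_add_neg] using h
end

section
/- No two edges of the wall W are nested with respect to the diagonal order ⪯: there do not exist edges p q and p' q' of W with p ≺ p' ≺ q' ≺ q. -/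
/-- No two edges of the wall are nested with respect to the diagonal order: there are
no edges `pq` and `p'q'` with `p ≺ p' ≺ q' ≺ q`. -/
theorem stmt6 (p q p' q' : ℤ × ℤ) (h : Wall.Adj p q) (h' : Wall.Adj p' q') :
    ¬(DiagLT p p' ∧ DiagLT p' q' ∧ DiagLT q' q) := by
  obtain ⟨x, y⟩ := p
  obtain ⟨z, w⟩ := q
  obtain ⟨x', y'⟩ := p'
  obtain ⟨z', w'⟩ := q'
  simp only [Wall, SimpleGraph.fromRel_adj, WallRel, Prod.mk.injEq] at h h'
  simp only [DiagLT]
  omega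
end

section
/- The wall W has a strict 2-queue layout with respect to the diagonal order ⪯: there is a partition of E(W) into two sets such that no two edges in the same set are nested with respect to ⪯, and moreover for all edges pq and pr of W with p ≺ q ≺ r or r ≺ q ≺ p, the edges pq and pr lie in distinct sets. Explicitly, for each vertex (x,y) with x + y even, place the edges (x,y)(x+1,y) and (x,y)(x−1,y) in the first queue and the edge (x,y)(x,y+1) in the second queue. -/
/-- The endpoints of an edge of the wall agree in one coordinate and differ by one in the other. -/
theorem Wall.coords_of_adj {p q : ℤ × ℤ} (h : Wall.Adj p q) :
    (p.2 = q.2 ∧ (q.1 = p.1 + 1 ∨ p.1 = q.1 + 1)) ∨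
      (p.1 = q.1 ∧ (q.2 = p.2 + 1 ∨ p.2 = q.2 + 1)) := by
  obtain ⟨-, (h | ⟨-, h⟩) | (h | ⟨-, h⟩)⟩ := (SimpleGraph.fromRel_adj _ _ _).1 h <;>
    simp [h]

/-- The wall has a strict 2-queue layout with respect to the diagonal order, with the
first queue consisting of the horizontal edges (for each `(x,y)` with `x+y` even, the
edges `(x,y)(x+1,y)` and `(x,y)(x−1,y)`, i.e. the edges whose endpoints share their
second coordinate) and the second queue of the vertical edges (the edges
`(x,y)(x,y+1)`, whose endpoints share their first coordinate):
* every edge of the wall is in exactly one of the two queues;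
* no two edges in the same queue are nested with respect to the diagonal order;
* (strictness) any two edges `pq`, `pr` whose other endpoints `q`, `r` lie on the same
  side of `p` in the diagonal order are in distinct queues. -/
theorem stmt7 :
    (∀ p q : ℤ × ℤ, Wall.Adj p q → Xor' (p.2 = q.2) (p.1 = q.1)) ∧
    (∀ p q p' q' : ℤ × ℤ, Wall.Adj p q → Wall.Adj p' q' →
      ((p.2 = q.2 ∧ p'.2 = q'.2) ∨ (p.1 = q.1 ∧ p'.1 = q'.1)) →
      ¬(DiagLT p p' ∧ DiagLT p' q' ∧ DiagLT q' q)) ∧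
    (∀ p q r : ℤ × ℤ, Wall.Adj p q → Wall.Adj p r →
      ((DiagLT p q ∧ DiagLT q r) ∨ (DiagLT r q ∧ DiagLT q p)) →
      ¬((p.2 = q.2 ∧ p.2 = r.2) ∨ (p.1 = q.1 ∧ p.1 = r.1))) := by
  refine ⟨fun p q h ↦ ?_, fun p q p' q' h h' hs hn ↦ ?_, fun p q r h h' hs hn ↦ ?_⟩
  · have := Wall.coords_of_adj h
    refine xor_def.2 ?_
    omega
  · have := Wall.coords_of_adj h
    have := Wall.coords_of_adj h'
    unfold DiagLT at hn
    omega
  · have := Wall.coords_of_adj h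
    have := Wall.coords_of_adj h'
    unfold DiagLT at hs
    omega
end

section
/- The wall W has a 4-track layout such that for all distinct edges pq and pr of W, the vertices q and r are in distinct tracks. Explicitly, the four tracks are the colour classes of the colouring (x,y) ↦ (x + 2y) mod 4, each totally ordered by the order (x,y) ⪯ (x',y') iff x < x', or x = x' and y ≤ y'; with these tracks, no two edges of W between the same pair of tracks cross, and for any vertex p its neighbours lie in pairwise distinct tracks. -/
/-- The colouring `(x,y) ↦ (x + 2y) mod 4` whose colour classes are the four tracks. -/
def wallColour (p : ℤ × ℤ) : ZMod 4 := ((p.1 + 2 * p.2 : ℤ) : ZMod 4)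

/-- The order within each track: `p ≺ q` iff `p.1 < q.1`, or `p.1 = q.1` and
`p.2 < q.2`. -/
def ColLT (p q : ℤ × ℤ) : Prop := p.1 < q.1 ∨ (p.1 = q.1 ∧ p.2 < q.2)

theorem wall_adj_cases {p q : ℤ × ℤ} (h : Wall.Adj p q) :
    (q.1 = p.1 + 1 ∧ q.2 = p.2) ∨ (p.1 = q.1 + 1 ∧ p.2 = q.2) ∨
    ((p.1 + p.2) % 2 = 0 ∧ q.1 = p.1 ∧ q.2 = p.2 + 1) ∨
    ((p.1 + p.2) % 2 = 1 ∧ q.1 = p.1 ∧ p.2 = q.2 + 1) := by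
  obtain ⟨-, (h | ⟨he, h⟩) | (h | ⟨he, h⟩)⟩ := h <;>
    simp only [Prod.ext_iff, Int.even_iff] at * <;> omega

theorem wallColour_eq_iff {p q : ℤ × ℤ} :
    wallColour p = wallColour q ↔ (p.1 + 2 * p.2) % 4 = (q.1 + 2 * q.2) % 4 :=
  ZMod.intCast_eq_intCast_iff' _ _ 4

/-- The wall has a 4-track layout such that the neighbours of any vertex lie in
pairwise distinct tracks.  The tracks are the colour classes of
`(x,y) ↦ (x+2y) mod 4`, each ordered by `ColLT`:
* each track is an independent set (adjacent vertices get distinct colours);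
* no two edges between the same pair of tracks cross;
* for any two distinct edges `pq` and `pr`, the vertices `q` and `r` are in distinct
  tracks. -/
theorem stmt9 :
    (∀ p q : ℤ × ℤ, Wall.Adj p q → wallColour p ≠ wallColour q) ∧
    (∀ v w x y : ℤ × ℤ, Wall.Adj v w → Wall.Adj x y →
      wallColour v = wallColour x → wallColour w = wallColour y →
      ¬(ColLT v x ∧ ColLT y w)) ∧
    (∀ p q r : ℤ × ℤ, Wall.Adj p q → Wall.Adj p r → q ≠ r →
      wallColour q ≠ wallColour r) := by
  refine ⟨fun p q h hc => ?_, fun v w x y h h' hc hc' ⟨hl, hl'⟩ => ?_,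
    fun p q r h h' hne hc => ?_⟩
  · rw [wallColour_eq_iff] at hc
    have := wall_adj_cases h
    omega
  · rw [wallColour_eq_iff] at hc hc'
    unfold ColLT at hl hl'
    rcases wall_adj_cases h with h | h | h | h <;>
      rcases wall_adj_cases h' with h' | h' | h' | h' <;> omega
  · rw [wallColour_eq_iff] at hc
    rw [Ne, Prod.ext_iff] at hne
    have := wall_adj_cases h
    have := wall_adj_cases h'
    omega
end

section
/- Suppose that there exist ε ∈ (0,1] and an integer d ≥ 1 such that for every N ∈ ℕ there is a finite d-monotone bipartite ε-expander with more than N vertices. Then there exists ε' > 0 such that for every N ∈ ℕ there is a finite 3-monotone bipartite ε'-expander with more than N vertices. -/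
open Finset

/-- The involution of `{0, …, r - 1}` swapping `2k` with `2k + 1`, where a last even point
without partner is fixed. -/
def evenSwap {r : ℕ} (i : Fin r) : Fin r :=
  if h : i.1 % 2 = 0 then (if h' : i.1 + 1 < r then ⟨i.1 + 1, h'⟩ else i)
  else ⟨i.1 - 1, by omega⟩

/-- The involution of `{0, …, r - 1}` swapping `2k + 1` with `2k + 2`, where `0` and a last odd
point without partner are fixed. -/
def oddSwap {r : ℕ} (i : Fin r) : Fin r :=
  if h : i.1 % 2 = 1 then (if h' : i.1 + 1 < r then ⟨i.1 + 1, h'⟩ else i)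
  else ⟨i.1 - 1, by omega⟩

lemma evenSwap_val {r : ℕ} (i : Fin r) :
    (evenSwap i).1 = if i.1 % 2 = 0 then (if i.1 + 1 < r then i.1 + 1 else i.1) else i.1 - 1 := by
  unfold evenSwap; split_ifs <;> rfl

lemma oddSwap_val {r : ℕ} (i : Fin r) :
    (oddSwap i).1 = if i.1 % 2 = 1 then (if i.1 + 1 < r then i.1 + 1 else i.1) else i.1 - 1 := by
  unfold oddSwap; split_ifs <;> rfl

lemma evenSwap_involutive {r : ℕ} : Function.Involutive (evenSwap (r := r)) := by
  intro i
  apply Fin.ext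
  have h := evenSwap_val i
  have h2 := evenSwap_val (evenSwap i)
  have := i.2
  split_ifs at h h2 <;> omega

lemma oddSwap_involutive {r : ℕ} : Function.Involutive (oddSwap (r := r)) := by
  intro i
  apply Fin.ext
  have h := oddSwap_val i
  have h2 := oddSwap_val (oddSwap i)
  have := i.2
  split_ifs at h h2 <;> omega

/-- The two swaps together act transitively: a nonempty set with the same image under both is
everything. -/
lemma eq_univ_of_image_swap_eq {r : ℕ} {T : Finset (Fin r)} (hT : T.Nonempty)
    (h : T.image evenSwap = T.image oddSwap) : T = univ := by
  have h1 : ∀ i ∈ T, oddSwap (evenSwap i) ∈ T := by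
    intro i hi
    have : evenSwap i ∈ T.image oddSwap := h ▸ mem_image_of_mem _ hi
    obtain ⟨j, hj, hji⟩ := mem_image.1 this
    rwa [← hji, oddSwap_involutive]
  have h2 : ∀ i ∈ T, evenSwap (oddSwap i) ∈ T := by
    intro i hi
    have : oddSwap i ∈ T.image evenSwap := h ▸ mem_image_of_mem _ hi
    obtain ⟨j, hj, hji⟩ := mem_image.1 this
    rwa [← hji, evenSwap_involutive]
  have key : ∀ i ∈ T, ∀ j : Fin r,
      (j.1 = (oddSwap (evenSwap i)).1 ∨ j.1 = (evenSwap (oddSwap i)).1) → j ∈ T := by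
    rintro i hi j (hj | hj)
    · rw [Fin.ext hj]; exact h1 i hi
    · rw [Fin.ext hj]; exact h2 i hi
  have step : ∀ i ∈ T, ∀ j : Fin r,
      (j.1 = i.1 + 2 ∨ i.1 = j.1 + 2 ∨ (i.1 ≤ 1 ∧ j.1 ≤ 1)) → j ∈ T := by
    intro i hi j hij
    by_cases hne : j = i
    · rwa [hne]
    have hne' : j.1 ≠ i.1 := fun h => hne (Fin.ext h)
    refine key i hi j ?_
    have a := evenSwap_val i
    have b := oddSwap_val (evenSwap i)
    have c := oddSwap_val i
    have e := evenSwap_val (oddSwap i)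
    have := i.2
    have := j.2
    rcases Nat.mod_two_eq_zero_or_one i.1 with hp | hp
    all_goals
      split_ifs at a c <;> split_ifs at b e <;> omega
  obtain ⟨i₀, hi₀⟩ := hT
  have down : ∀ k : ℕ, ∀ i ∈ T, i.1 = k → ∃ j ∈ T, j.1 ≤ 1 := by
    intro k
    induction k using Nat.strong_induction_on with
    | _ k ih =>
      intro i hi hik
      by_cases hk : k ≤ 1
      · exact ⟨i, hi, by omega⟩
      · exact ih (k - 2) (by omega) ⟨k - 2, by omega⟩
          (step i hi _ (Or.inr (Or.inl (by simp only; omega)))) rfl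
  obtain ⟨j, hj, hj1⟩ := down _ i₀ hi₀ rfl
  have up : ∀ k : ℕ, ∀ i : Fin r, i.1 = k → i ∈ T := by
    intro k
    induction k using Nat.strong_induction_on with
    | _ k ih =>
      intro i hik
      by_cases hk : k ≤ 1
      · exact step j hj i (by omega)
      · exact step _ (ih (k - 2) (by omega) ⟨k - 2, by omega⟩ rfl) i
          (Or.inl (by simp only; omega))
  exact eq_univ_iff_forall.2 fun i => up _ i rfl

lemma card_le_card_of_swap_mem {r : ℕ} {T U : Finset (Fin r)}
    (h : ∀ i ∈ T, evenSwap i ∈ U) : T.card ≤ U.card := by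
  rw [← card_image_of_injective T evenSwap_involutive.injective]
  exact card_le_card (image_subset_iff.2 h)

lemma card_lt_card_of_swap_mem {r : ℕ} {T U : Finset (Fin r)}
    (h : ∀ i ∈ T, evenSwap i ∈ U ∧ oddSwap i ∈ U) (hne : T.Nonempty) (hT : T ≠ univ) :
    T.card < U.card := by
  by_contra! hc
  have h1 : T.image evenSwap = U :=
    eq_of_subset_of_card_le (image_subset_iff.2 fun i hi => (h i hi).1)
      (by rwa [card_image_of_injective T evenSwap_involutive.injective])
  have h2 : T.image oddSwap = U :=
    eq_of_subset_of_card_le (image_subset_iff.2 fun i hi => (h i hi).2)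
      (by rwa [card_image_of_injective T oddSwap_involutive.injective])
  exact hT (eq_univ_of_image_swap_eq hne (h1.trans h2.symm))

/-- Expansion of the unravelled graph, in terms of the fibres `T v` of a vertex set and
the fibres `U v` of its neighbourhood. -/
lemma sum_card_fibres_expand {n d : ℕ} {ε : ℝ} (hε0 : 0 < ε) (hε1 : ε ≤ 1)
    {E : Finset (Fin n × Fin n)} (hE : BipExpander E ε) (T U : Fin n → Finset (Fin (d + 2)))
    (hswap : ∀ v, ∀ i ∈ T v, evenSwap i ∈ U v ∧ oddSwap i ∈ U v)
    (hedge : ∀ e ∈ E, T e.1 = univ → (U e.2).Nonempty)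
    (hT : ((∑ v, (T v).card : ℕ) : ℝ) ≤ ((d + 2 : ℕ) : ℝ) * n / 2) :
    (1 + ε / (2 * (d + 2))) * ((∑ v, (T v).card : ℕ) : ℝ) ≤ ((∑ v, (U v).card : ℕ) : ℝ) := by
  set F : Finset (Fin n) := univ.filter fun v => T v = univ with hF
  set P : Finset (Fin n) := univ.filter fun v => (T v).Nonempty ∧ T v ≠ univ with hP
  have hle : ∀ v, (T v).card ≤ (U v).card := fun v =>
    card_le_card_of_swap_mem fun i hi => (hswap v i hi).1
  have hlt : ∀ v ∈ P, (T v).card < (U v).card := fun v hv =>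
    card_lt_card_of_swap_mem (hswap v) (mem_filter.1 hv).2.1 (mem_filter.1 hv).2.2
  have gain : ∀ Q : Finset (Fin n), (∀ v ∈ Q, (T v).card < (U v).card) →
      ∑ v, (T v).card + Q.card ≤ ∑ v, (U v).card := by
    intro Q hQ
    have : Q.card = ∑ v, if v ∈ Q then 1 else 0 := by simp
    rw [this, ← sum_add_distrib]
    refine sum_le_sum fun v _ => ?_
    split_ifs with h
    · exact hQ v h
    · exact hle v
  have gP := gain P hlt
  have gN := gain (nbhdA E F \ F) (by
    intro v hv
    obtain ⟨hvN, hvF⟩ := mem_sdiff.1 hv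
    have hvu : T v ≠ univ := fun h => hvF (mem_filter.2 ⟨mem_univ _, h⟩)
    rcases (T v).eq_empty_or_nonempty with h0 | h0
    · obtain ⟨e, he, rfl⟩ := mem_image.1 hvN
      obtain ⟨heE, heF⟩ := mem_filter.1 he
      rw [h0, card_empty]
      exact (hedge e heE (mem_filter.1 heF).2).card_pos
    · exact hlt v (mem_filter.2 ⟨mem_univ _, h0, hvu⟩))
  have upper : ∑ v, (T v).card ≤ (d + 2) * (F.card + P.card) := by
    have h1 : F.card = ∑ v, if v ∈ F then 1 else 0 := by simp
    have h2 : P.card = ∑ v, if v ∈ P then 1 else 0 := by simp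
    rw [h1, h2, ← sum_add_distrib, mul_sum]
    refine sum_le_sum fun v _ => ?_
    have hc : (T v).card ≤ d + 2 := by simpa using card_le_univ (T v)
    rcases (T v).eq_empty_or_nonempty with h0 | h0
    · simp [h0]
    · by_cases hu : T v = univ
      · have : v ∈ F := mem_filter.2 ⟨mem_univ _, hu⟩
        rw [if_pos this]
        exact hc.trans (Nat.le_mul_of_pos_right _ (by omega))
      · have : v ∈ P := mem_filter.2 ⟨mem_univ _, h0, hu⟩
        rw [if_pos this]
        exact hc.trans (Nat.le_mul_of_pos_right _ (by omega))
  have lower : (d + 2) * F.card ≤ ∑ v, (T v).card := by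
    calc (d + 2) * F.card = ∑ v ∈ F, (T v).card := by
          rw [sum_congr rfl fun v hv => by rw [(mem_filter.1 hv).2], sum_const]
          simp [mul_comm]
      _ ≤ _ := sum_le_sum_of_subset (subset_univ F)
  have hFn : (F.card : ℝ) ≤ (n : ℝ) / 2 := by
    have h1 : ((d + 2 : ℕ) : ℝ) * F.card ≤ ((∑ v, (T v).card : ℕ) : ℝ) := by exact_mod_cast lower
    have h2 : (0 : ℝ) < ((d + 2 : ℕ) : ℝ) := by positivity
    refine le_of_mul_le_mul_left ?_ h2
    linarith
  have hexp := hE F hFn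
  have hsd : (nbhdA E F).card ≤ (nbhdA E F \ F).card + F.card := by
    have := le_card_sdiff F (nbhdA E F)
    omega
  generalize ∑ v, (T v).card = a at *
  generalize ∑ v, (U v).card = b at *
  have gP' : (a : ℝ) + P.card ≤ b := by exact_mod_cast gP
  have gN' : (a : ℝ) + (nbhdA E F \ F).card ≤ b := by exact_mod_cast gN
  have hsd' : ((nbhdA E F).card : ℝ) ≤ (nbhdA E F \ F).card + F.card := by exact_mod_cast hsd
  have up' : (a : ℝ) ≤ (d + 2) * (F.card + P.card) := by exact_mod_cast upper
  have hm : ε / (2 * (d + 2)) * a ≤ ε / 2 * (F.card + P.card) := by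
    calc ε / (2 * (d + 2)) * (a : ℝ)
        ≤ ε / (2 * (d + 2)) * ((d + 2) * (F.card + P.card)) := by gcongr
      _ = _ := by field_simp
  have hPε : ε * (P.card : ℝ) ≤ P.card := mul_le_of_le_one_left (by positivity) hε1
  linarith

/-- The edges of the unravelled graph, for matching number `s`: vertices are pairs of a block in
`Fin (d + 2)` and a vertex of the original graph. -/
def UnravelAdj {n d : ℕ} (M : Fin d → Finset (Fin n × Fin n)) (s : Fin 3)
    (x y : Fin (d + 2) × Fin n) : Prop :=
  (s = 0 ∧ y.1.1 = x.1.1 + 1 ∧ x.2 = y.2) ∨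
  (s = 1 ∧ x.1.1 = y.1.1 + 1 ∧ x.2 = y.2) ∨
  (s = 2 ∧ x.1 = y.1 ∧ (((x.1.1 = 0 ∨ x.1.1 = d + 1) ∧ x.2 = y.2) ∨
    ∃ t : Fin d, x.1.1 = t.1 + 1 ∧ (x.2, y.2) ∈ M t))

open Classical in
/-- The monotone matchings of the unravelled graph, with the vertices ordered
lexicographically. -/
noncomputable def unravelMatching {n d : ℕ} (M : Fin d → Finset (Fin n × Fin n)) (s : Fin 3) :
    Finset (Fin ((d + 2) * n) × Fin ((d + 2) * n)) :=
  univ.filter fun e => UnravelAdj M s (finProdFinEquiv.symm e.1) (finProdFinEquiv.symm e.2)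

lemma finProdFinEquiv_lt_iff {m n : ℕ} (x y : Fin m × Fin n) :
    finProdFinEquiv x < finProdFinEquiv y ↔ x.1 < y.1 ∨ (x.1 = y.1 ∧ x.2 < y.2) := by
  obtain ⟨⟨a, ha⟩, ⟨b, hb⟩⟩ := x
  obtain ⟨⟨c, hc⟩, ⟨e, he⟩⟩ := y
  simp only [Fin.lt_def, finProdFinEquiv_apply_val, Fin.mk.injEq]
  rcases lt_trichotomy a c with h | rfl | h
  · have : n * (a + 1) ≤ n * c := Nat.mul_le_mul_left n h
    rw [Nat.mul_succ] at this
    constructor <;> intro <;> omega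
  · omega
  · have : n * (c + 1) ≤ n * a := Nat.mul_le_mul_left n h
    rw [Nat.mul_succ] at this
    constructor <;> intro <;> omega

lemma monotoneMatching_of_strict {n m : ℕ} {M : Finset (Fin n × Fin m)}
    (hlt : ∀ e ∈ M, ∀ f ∈ M, e.1 < f.1 → e.2 < f.2)
    (heq : ∀ e ∈ M, ∀ f ∈ M, e.1 = f.1 → e.2 = f.2) : MonotoneMatching M := by
  refine ⟨fun e he f hf hne => ?_, fun e he f hf h => lt_asymm (hlt e he f hf h.1) h.2⟩
  have h1 : e.1 ≠ f.1 := fun h => hne (Prod.ext h (heq e he f hf h))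
  refine ⟨h1, ?_⟩
  rcases lt_or_gt_of_ne h1 with h | h
  · exact (hlt e he f hf h).ne
  · exact (hlt f hf e he h).ne'

lemma MonotoneMatching.lt {n m : ℕ} {M : Finset (Fin n × Fin m)} (hM : MonotoneMatching M)
    {a a' : Fin n} {b b' : Fin m} (h : (a, b) ∈ M) (h' : (a', b') ∈ M) (hlt : a < a') :
    b < b' := by
  have h1 := (hM.1 _ h _ h' (fun e => hlt.ne (Prod.ext_iff.1 e).1)).2
  exact lt_of_le_of_ne (not_lt.1 fun hb => hM.2 _ h _ h' ⟨hlt, hb⟩) h1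

lemma MonotoneMatching.eq {n m : ℕ} {M : Finset (Fin n × Fin m)} (hM : MonotoneMatching M)
    {a : Fin n} {b b' : Fin m} (h : (a, b) ∈ M) (h' : (a, b') ∈ M) : b = b' := by
  by_contra hne
  exact (hM.1 _ h _ h' (fun e => hne (Prod.ext_iff.1 e).2)).1 rfl

lemma monotoneMatching_unravelMatching {n d : ℕ} {M : Fin d → Finset (Fin n × Fin n)}
    (hM : ∀ t, MonotoneMatching (M t)) (s : Fin 3) : MonotoneMatching (unravelMatching M s) := by
  apply monotoneMatching_of_strict
  · rintro ⟨e, e'⟩ he ⟨f, f'⟩ hf hlt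
    obtain ⟨x, rfl⟩ := finProdFinEquiv.surjective e
    obtain ⟨x', rfl⟩ := finProdFinEquiv.surjective e'
    obtain ⟨y, rfl⟩ := finProdFinEquiv.surjective f
    obtain ⟨y', rfl⟩ := finProdFinEquiv.surjective f'
    simp only [unravelMatching, mem_filter, mem_univ, true_and, Equiv.symm_apply_apply] at he hf
    rw [finProdFinEquiv_lt_iff] at hlt ⊢
    obtain ⟨i, v⟩ := x
    obtain ⟨i', v'⟩ := x'
    obtain ⟨j, w⟩ := y
    obtain ⟨j', w'⟩ := y'
    simp only [UnravelAdj] at he hf hlt ⊢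
    rcases he with ⟨rfl, h1, h2⟩ | ⟨rfl, h1, h2⟩ | ⟨rfl, h1, h2⟩
    · simp at hf
      omega
    · simp at hf
      omega
    · simp [-Fin.val_eq_zero_iff] at hf
      obtain ⟨h3, h4⟩ := hf
      subst h1 h3
      rcases hlt with h | ⟨rfl, h⟩
      · exact Or.inl h
      refine Or.inr ⟨rfl, ?_⟩
      rcases h2 with ⟨h5, rfl⟩ | ⟨t, ht, h5⟩
      · rcases h4 with ⟨-, rfl⟩ | ⟨t, ht, -⟩
        · exact h
        · omega
      · rcases h4 with ⟨h6, rfl⟩ | ⟨t', ht', h6⟩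
        · omega
        · obtain rfl : t = t' := Fin.ext (by omega)
          exact (hM t).lt h5 h6 h
  · rintro ⟨e, e'⟩ he ⟨f, f'⟩ hf heq
    obtain ⟨x, rfl⟩ := finProdFinEquiv.surjective e
    obtain ⟨x', rfl⟩ := finProdFinEquiv.surjective e'
    obtain ⟨y', rfl⟩ := finProdFinEquiv.surjective f'
    obtain rfl : finProdFinEquiv x = f := heq
    simp only [unravelMatching, mem_filter, mem_univ, true_and, Equiv.symm_apply_apply] at he hf
    obtain ⟨i, v⟩ := x
    obtain ⟨i', v'⟩ := x'
    obtain ⟨j', w'⟩ := y'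
    simp only [UnravelAdj] at he hf
    suffices i' = j' ∧ v' = w' by rw [this.1, this.2]
    rcases he with ⟨rfl, h1, h2⟩ | ⟨rfl, h1, h2⟩ | ⟨rfl, h1, h2⟩
    · simp at hf
      omega
    · simp at hf
      omega
    · simp [-Fin.val_eq_zero_iff] at hf
      obtain ⟨h3, h4⟩ := hf
      subst h1 h3
      refine ⟨rfl, ?_⟩
      rcases h2 with ⟨h5, rfl⟩ | ⟨t, ht, h5⟩
      · rcases h4 with ⟨-, rfl⟩ | ⟨t, ht, -⟩
        · rfl
        · omega
      · rcases h4 with ⟨h6, rfl⟩ | ⟨t', ht', h6⟩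
        · omega
        · obtain rfl : t = t' := Fin.ext (by omega)
          exact (hM t).eq h5 h6

lemma sum_card_fibres {m n : ℕ} (S : Finset (Fin (m * n))) :
    ∑ v : Fin n, (univ.filter fun i : Fin m => finProdFinEquiv (i, v) ∈ S).card = S.card := by
  simp only [card_filter]
  rw [sum_comm, ← Fintype.sum_prod_type' (f := fun (i : Fin m) (v : Fin n) =>
    if finProdFinEquiv (i, v) ∈ S then 1 else 0),
    Equiv.sum_comp finProdFinEquiv (fun x => if x ∈ S then 1 else 0)]
  simp

lemma mem_nbhdA_unravel {n d : ℕ} {M : Fin d → Finset (Fin n × Fin n)}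
    {S : Finset (Fin ((d + 2) * n))} {x y : Fin (d + 2) × Fin n} (s : Fin 3)
    (h : UnravelAdj M s x y) (hx : finProdFinEquiv x ∈ S) :
    finProdFinEquiv y ∈ nbhdA (univ.biUnion (unravelMatching M)) S := by
  refine mem_image.2 ⟨(finProdFinEquiv x, finProdFinEquiv y), mem_filter.2 ⟨?_, hx⟩, rfl⟩
  exact mem_biUnion.2 ⟨s, mem_univ _, by simpa [unravelMatching] using h⟩

lemma bipExpander_unravel {n d : ℕ} {ε : ℝ} (hε0 : 0 < ε) (hε1 : ε ≤ 1)
    {M : Fin d → Finset (Fin n × Fin n)} (hE : BipExpander (univ.biUnion M) ε) :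
    BipExpander (univ.biUnion (unravelMatching M)) (ε / (2 * (d + 2))) := by
  intro S hS
  rw [← sum_card_fibres S] at hS ⊢
  rw [← sum_card_fibres (nbhdA _ S)]
  refine sum_card_fibres_expand hε0 hε1 hE _ _ ?_ ?_ (by rwa [Nat.cast_mul] at hS)
  · intro v i hi
    have hi' := (mem_filter.1 hi).2
    have near : ∀ j : Fin (d + 2), (j.1 = i.1 + 1 ∨ i.1 = j.1 + 1 ∨
        (j.1 = i.1 ∧ (i.1 = 0 ∨ i.1 = d + 1))) →
        j ∈ univ.filter fun k => finProdFinEquiv (k, v) ∈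
          nbhdA (univ.biUnion (unravelMatching M)) S := by
      intro j hj
      refine mem_filter.2 ⟨mem_univ _, ?_⟩
      rcases hj with h | h | ⟨h, h'⟩
      · exact mem_nbhdA_unravel (x := (i, v)) 0 (Or.inl ⟨rfl, h, rfl⟩) hi'
      · exact mem_nbhdA_unravel (x := (i, v)) 1 (Or.inr (Or.inl ⟨rfl, h, rfl⟩)) hi'
      · exact mem_nbhdA_unravel (x := (i, v)) 2
          (Or.inr (Or.inr ⟨rfl, (Fin.ext h).symm, Or.inl ⟨h', rfl⟩⟩)) hi'
    have := i.2
    constructor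
    · apply near
      have h := evenSwap_val i
      split_ifs at h <;> omega
    · apply near
      have h := oddSwap_val i
      split_ifs at h <;> omega
  · rintro ⟨v, w⟩ he hu
    obtain ⟨t, -, ht⟩ := mem_biUnion.1 he
    let i : Fin (d + 2) := ⟨t.1 + 1, by omega⟩
    have hi : finProdFinEquiv (i, v) ∈ S := (mem_filter.1 (eq_univ_iff_forall.1 hu i)).2
    exact ⟨i, mem_filter.2 ⟨mem_univ _, mem_nbhdA_unravel (x := (i, v)) 2
      (Or.inr (Or.inr ⟨rfl, rfl, Or.inr ⟨t, rfl, ht⟩⟩)) hi⟩⟩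

/-- If there is an infinite family of `d`-monotone bipartite `ε`-expanders (i.e. for
every `N` such an expander with more than `N` vertices; a bipartite graph on colour
classes of size `n` has `2n` vertices), then there is an infinite family of
`3`-monotone bipartite `ε'`-expanders, for some `ε' > 0`. -/
theorem stmt12 (ε : ℝ) (hε0 : 0 < ε) (hε1 : ε ≤ 1) (d : ℕ) (hd : 1 ≤ d)
    (h : ∀ N : ℕ, ∃ n : ℕ, N < 2 * n ∧ ∃ E : Finset (Fin n × Fin n),
      IsMonotoneGraph E d ∧ BipExpander E ε) :
    ∃ ε' : ℝ, 0 < ε' ∧ ∀ N : ℕ, ∃ n : ℕ, N < 2 * n ∧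
      ∃ E : Finset (Fin n × Fin n), IsMonotoneGraph E 3 ∧ BipExpander E ε' := by
  refine ⟨ε / (2 * (d + 2)), by positivity, fun N => ?_⟩
  obtain ⟨n, hn, E, ⟨M, hM, rfl⟩, hE⟩ := h N
  exact ⟨(d + 2) * n, by nlinarith, _, ⟨unravelMatching M, monotoneMatching_unravelMatching hM, rfl⟩,
    bipExpander_unravel hε0 hε1 hE⟩
end

section
/- Suppose that there exist ε ∈ (0,1] and an integer d ≥ 1 such that for every N ∈ ℕ there is a finite d-monotone bipartite ε-expander with more than N vertices. Then there exists ε' > 0 such that for every N ∈ ℕ there is a finite bipartite ε'-expander with more than N vertices that admits a 3-pushdown book embedding. -/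
/-- Two edges with endpoint positions `{a,b}` and `{c,d}` cross:
one of them has exactly one endpoint strictly inside the other. -/
def CrossNat (a b c d : ℕ) : Prop :=
  (min a b < min c d ∧ min c d < max a b ∧ max a b < max c d) ∨
  (min c d < min a b ∧ min a b < max c d ∧ max c d < max a b)

/-- A `p`-pushdown book embedding of the bipartite graph with edge set `E`: a linear
order of the vertices (an injection into `ℕ`) together with a partition of `E` into
`p` parts, each of which is a non-crossing matching. -/
def HasPushdownEmbedding {n m : ℕ} (E : Finset (Fin n × Fin m)) (p : ℕ) : Prop :=
  ∃ σ : (Fin n ⊕ Fin m) → ℕ, Function.Injective σ ∧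
    ∃ J : Fin p → Finset (Fin n × Fin m),
      (∀ s t, s ≠ t → Disjoint (J s) (J t)) ∧
      Finset.univ.biUnion J = E ∧
      ∀ t, (∀ e ∈ J t, ∀ f ∈ J t, e ≠ f → e.1 ≠ f.1 ∧ e.2 ≠ f.2) ∧
        (∀ e ∈ J t, ∀ f ∈ J t,
          ¬CrossNat (σ (.inl e.1)) (σ (.inr e.2)) (σ (.inl f.1)) (σ (.inr f.2)))

lemma hasPushdownEmbedding_biUnion {n m p : ℕ} (σ : Fin n ⊕ Fin m → ℕ)
    (hσ : Function.Injective σ) (J : Fin p → Finset (Fin n × Fin m))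
    (hmatch : ∀ t, ∀ e ∈ J t, ∀ f ∈ J t, e ≠ f → e.1 ≠ f.1 ∧ e.2 ≠ f.2)
    (hcross : ∀ t, ∀ e ∈ J t, ∀ f ∈ J t,
      ¬CrossNat (σ (.inl e.1)) (σ (.inr e.2)) (σ (.inl f.1)) (σ (.inr f.2))) :
    HasPushdownEmbedding (Finset.univ.biUnion J) p := by
  have hsub : ∀ t, disjointed J t ⊆ J t := disjointed_le J
  refine ⟨σ, hσ, disjointed J, fun s t hst => disjoint_disjointed J hst, ?_, fun t =>
    ⟨fun e he f hf => hmatch t e (hsub t he) f (hsub t hf),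
      fun e he f hf => hcross t e (hsub t he) f (hsub t hf)⟩⟩
  rw [← Finset.sup_eq_biUnion, ← Finset.sup_eq_biUnion]
  exact Fintype.sup_disjointed J

lemma card_eq_sum_card_slice {d n : ℕ} (S : Finset (Fin (d * n))) :
    S.card = ∑ t : Fin d, (Finset.univ.filter (fun x => finProdFinEquiv (t, x) ∈ S)).card := by
  classical
  rw [← Finset.card_sigma]
  refine Finset.card_bij' (fun a _ => ⟨(finProdFinEquiv.symm a).1, (finProdFinEquiv.symm a).2⟩)
    (fun b _ => finProdFinEquiv (b.1, b.2)) ?_ ?_ ?_ ?_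
  · intro a ha
    rw [Finset.mem_sigma]
    refine ⟨Finset.mem_univ _, Finset.mem_filter.mpr ⟨Finset.mem_univ _, ?_⟩⟩
    rwa [Prod.mk.eta, Equiv.apply_symm_apply]
  · intro b hb
    simpa using hb
  · intro a ha
    exact finProdFinEquiv.apply_symm_apply a
  · rintro ⟨t, x⟩ hb
    simp

/-- If the sets of a cyclic family all differ little from their predecessors, then any two
members of the family differ little. -/
lemma card_sdiff_le_sum_cyclic {α : Type*} [DecidableEq α] {k : ℕ}
    (S : Fin (k + 1) → Finset α) (u t : Fin (k + 1)) :
    (S u \ S t).card ≤ ∑ v, (S (v + 1) \ S v).card := by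
  refine (Finset.card_le_card ?_).trans Finset.card_biUnion_le
  intro x hx
  by_contra hcon
  simp only [Finset.mem_biUnion, Finset.mem_univ, true_and, Finset.mem_sdiff, not_exists,
    not_and, not_not] at hcon hx
  have key : ∀ w : Fin (k + 1), x ∉ S (t + w) := by
    intro w
    induction w using Fin.induction with
    | zero => simpa using hx.2
    | succ i ih =>
      intro h
      apply ih
      apply hcon
      rwa [add_assoc, Fin.coeSucc_eq_succ]
  apply key (u - t)
  simpa using hx.1

lemma card_nbhdA_sdiff_le {n : ℕ} {M : Finset (Fin n × Fin n)}
    (hM : ∀ e ∈ M, ∀ f ∈ M, e ≠ f → e.1 ≠ f.1 ∧ e.2 ≠ f.2) (S T : Finset (Fin n)) :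
    (nbhdA M T \ T).card ≤ (nbhdA M S \ S).card + (T \ S).card + (S \ T).card := by
  have hinj : (nbhdA M (T \ S)).card ≤ (T \ S).card := by
    unfold nbhdA
    refine Finset.card_image_le.trans ?_
    refine Finset.card_le_card_of_injOn Prod.fst ?_ ?_
    · intro e he
      exact (Finset.mem_filter.mp he).2
    · intro e he f hf hef
      by_contra hne
      exact (hM e (Finset.mem_filter.mp he).1 f (Finset.mem_filter.mp hf).1 hne).1 hef
  have hsub : nbhdA M T \ T ⊆ (nbhdA M S \ S) ∪ nbhdA M (T \ S) ∪ (S \ T) := by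
    intro y hy
    simp only [nbhdA, Finset.mem_sdiff, Finset.mem_image, Finset.mem_filter, Finset.mem_union,
      Prod.exists, exists_eq_right] at hy ⊢
    obtain ⟨⟨x, hx, hxT⟩, hyT⟩ := hy
    by_cases hxS : x ∈ S
    · by_cases hyS : y ∈ S
      · exact Or.inr ⟨hyS, hyT⟩
      · exact Or.inl (Or.inl ⟨⟨x, hx, hxS⟩, hyS⟩)
    · exact Or.inl (Or.inr ⟨x, hx, hxT, hxS⟩)
  calc _ ≤ _ := Finset.card_le_card hsub
    _ ≤ _ := (Finset.card_union_le _ _).trans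
      (Nat.add_le_add_right (Finset.card_union_le _ _) _)
    _ ≤ _ := by omega

lemma expansion_of_excess {ε : ℝ} (hε0 : 0 < ε) (hε1 : ε ≤ 1) {k s c m X : ℕ}
    (hupp : s ≤ (k + 1) * (c + X)) (hexp : (1 + ε) * (c : ℝ) ≤ m)
    (hcover : m ≤ c + (2 * k + 3) * X) :
    (1 + ε / (2 * (k + 1) * (k + 2))) * (s : ℝ) ≤ ((s + X : ℕ) : ℝ) := by
  have hcover' : (m : ℝ) ≤ c + (2 * k + 3) * X := by exact_mod_cast hcover
  have hupp' : (s : ℝ) ≤ (k + 1) * (c + X) := by exact_mod_cast hupp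
  have hεc : ε * c ≤ (2 * k + 3) * X := by linarith
  have hεX : ε * X ≤ X := mul_le_of_le_one_left (Nat.cast_nonneg _) hε1
  have hfin : ε * s ≤ X * (2 * (k + 1) * (k + 2)) := by
    have h1 := mul_le_mul_of_nonneg_left hupp' hε0.le
    have h2 : ((k : ℝ) + 1) * (ε * c + ε * X) ≤ (k + 1) * ((2 * k + 3) * X + X) := by
      gcongr
    linarith
  rw [Nat.cast_add, add_mul, one_mul, div_mul_eq_mul_div]
  gcongr
  rwa [div_le_iff₀ (by positivity)]

/-- Expansion of the cyclic unravelling, phrased for the slices `S t` of a vertex set and the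
slices `N t` of its neighbourhood. -/
lemma cyclic_expansion {n k : ℕ} {ε : ℝ} (hε0 : 0 < ε) (hε1 : ε ≤ 1)
    (M : Fin (k + 1) → Finset (Fin n × Fin n))
    (hM : ∀ t, ∀ e ∈ M t, ∀ f ∈ M t, e ≠ f → e.1 ≠ f.1 ∧ e.2 ≠ f.2)
    (hE : BipExpander (Finset.univ.biUnion M) ε)
    (S N : Fin (k + 1) → Finset (Fin n)) (h0 : ∀ t, S t ⊆ N t) (h1 : ∀ t, S (t + 1) ⊆ N t)
    (h2 : ∀ t, nbhdA (M t) (S t) ⊆ N t)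
    (hS : ((∑ t, (S t).card : ℕ) : ℝ) ≤ ((k + 1 : ℕ) * n : ℝ) / 2) :
    (1 + ε / (2 * (k + 1) * (k + 2))) * ((∑ t, (S t).card : ℕ) : ℝ) ≤
      ((∑ t, (N t).card : ℕ) : ℝ) := by
  set X := ∑ t, (N t \ S t).card with hX
  have hN : ∑ t, (N t).card = ∑ t, (S t).card + X := by
    rw [hX, ← Finset.sum_add_distrib]
    refine Finset.sum_congr rfl fun t _ => ?_
    rw [add_comm, Finset.card_sdiff_add_card_eq_card (h0 t)]
  have hdiff : ∀ u t, (S u \ S t).card ≤ X := fun u t =>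
    (card_sdiff_le_sum_cyclic S u t).trans
      (Finset.sum_le_sum fun v _ => Finset.card_le_card (Finset.sdiff_subset_sdiff (h1 v) le_rfl))
  obtain ⟨t₀, -, hmin⟩ := Finset.exists_min_image Finset.univ (fun t => (S t).card)
    ⟨0, Finset.mem_univ _⟩
  set T := S t₀
  have hlow : (k + 1) * T.card ≤ ∑ t, (S t).card := by
    have := Finset.card_nsmul_le_sum Finset.univ (fun t => (S t).card) T.card hmin
    simpa using this
  have hupp : ∑ t, (S t).card ≤ (k + 1) * (T.card + X) := by
    have := Finset.sum_le_card_nsmul Finset.univ (fun t => (S t).card) (T.card + X) (by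
      intro t _
      have h := Finset.card_le_card_sdiff_add_card (s := S t) (t := T)
      have : (S t \ T).card ≤ X := hdiff t t₀
      omega)
    simpa using this
  have hTexp := hE T (by
    have hlow' : ((k + 1 : ℕ) : ℝ) * T.card ≤ ((∑ t, (S t).card : ℕ) : ℝ) := by
      exact_mod_cast hlow
    have hk : (0 : ℝ) < ((k + 1 : ℕ) : ℝ) := by positivity
    refine le_of_mul_le_mul_left ?_ hk
    linarith)
  have hcover : (nbhdA (Finset.univ.biUnion M) T).card ≤ T.card + (2 * k + 3) * X := by
    have hsub : nbhdA (Finset.univ.biUnion M) T ⊆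
        T ∪ Finset.univ.biUnion (fun t => nbhdA (M t) T \ T) := by
      intro y hy
      simp only [nbhdA, Finset.mem_sdiff, Finset.mem_image, Finset.mem_filter, Finset.mem_union,
        Finset.mem_biUnion, Finset.mem_univ, true_and,
        Prod.exists, exists_eq_right] at hy ⊢
      obtain ⟨x, ⟨t, hx⟩, hxT⟩ := hy
      by_cases hyT : y ∈ T
      · exact Or.inl hyT
      · exact Or.inr ⟨t, ⟨x, hx, hxT⟩, hyT⟩
    have hsum : ∑ t, (nbhdA (M t) T \ T).card ≤ ∑ t, ((N t \ S t).card + 2 * X) := by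
      refine Finset.sum_le_sum fun t _ => ?_
      have h3 := card_nbhdA_sdiff_le (hM t) (S t) T
      have h4 := Finset.card_le_card (Finset.sdiff_subset_sdiff (h2 t) (le_refl (S t)))
      have h5 : (S t \ T).card ≤ X := hdiff t t₀
      have h6 : (T \ S t).card ≤ X := hdiff t₀ t
      omega
    rw [Finset.sum_add_distrib, ← hX] at hsum
    simp only [Finset.sum_const, Finset.card_univ, Fintype.card_fin, smul_eq_mul] at hsum
    have h7 := (Finset.card_le_card hsub).trans ((Finset.card_union_le _ _).trans
      (Nat.add_le_add_left Finset.card_biUnion_le _))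
    nlinarith
  rw [hN]
  exact expansion_of_excess hε0 hε1 hupp hTexp hcover

/-- Adjacency in the three pages of the cyclic unravelling of the matchings `M`. It has layers
`A t` and `B t`, where `A t` is joined to `B t` by the identity and by `M t`, and `B t` is joined
to `A (t + 1)` by the identity. -/
def unravelAdj {n k : ℕ} (M : Fin (k + 1) → Finset (Fin n × Fin n))
    (a b : Fin (k + 1) × Fin n) : Fin 3 → Prop :=
  ![a.1 = b.1 ∧ a.2 = b.2, a.1 = b.1 + 1 ∧ a.2 = b.2, a.1 = b.1 ∧ (a.2, b.2) ∈ M a.1]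

open Classical in
/-- The edges of the `i`-th page of the cyclic unravelling of the matchings `M`. -/
noncomputable def unravelPage {n k : ℕ} (M : Fin (k + 1) → Finset (Fin n × Fin n)) (i : Fin 3) :
    Finset (Fin ((k + 1) * n) × Fin ((k + 1) * n)) :=
  Finset.univ.filter fun e =>
    unravelAdj M (finProdFinEquiv.symm e.1) (finProdFinEquiv.symm e.2) i

lemma mem_unravelPage {n k : ℕ} {M : Fin (k + 1) → Finset (Fin n × Fin n)} {i : Fin 3}
    {e : Fin ((k + 1) * n) × Fin ((k + 1) * n)} : e ∈ unravelPage M i ↔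
      unravelAdj M (finProdFinEquiv.symm e.1) (finProdFinEquiv.symm e.2) i := by
  simp only [unravelPage, Finset.mem_filter, Finset.mem_univ, true_and]

/-- The linear order of the cyclic unravelling: the layers `A 0, B 0, A 1, B 1, …` one after the
other, each `A t` increasing and each `B t` decreasing. -/
def unravelPos {n k : ℕ} : (Fin (k + 1) × Fin n) ⊕ (Fin (k + 1) × Fin n) → ℕ
  | .inl a => 2 * (a.1 * n) + a.2
  | .inr b => 2 * (b.1 * n) + (2 * n - 1 - b.2)

lemma mul_add_le_of_lt {k n : ℕ} {t u : Fin k} (h : t < u) : (t : ℕ) * n + n ≤ u * n := by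
  have : ((t : ℕ) + 1) * n ≤ u * n := Nat.mul_le_mul_right _ h
  linarith

lemma unravelPos_injective {n k : ℕ} :
    Function.Injective (unravelPos : (Fin (k + 1) × Fin n) ⊕ (Fin (k + 1) × Fin n) → ℕ) := by
  rintro (⟨t, x⟩ | ⟨t, x⟩) (⟨u, y⟩ | ⟨u, y⟩) h <;> simp only [unravelPos] at h <;>
    rcases lt_trichotomy t u with htu | rfl | htu <;>
    first
    | (have := mul_add_le_of_lt (n := n) htu; omega)
    | (exfalso; omega)
    | (obtain rfl : x = y := by ext; omega
       rfl)

lemma unravelAdj_matching {n k : ℕ} {M : Fin (k + 1) → Finset (Fin n × Fin n)}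
    (hM : ∀ t, MonotoneMatching (M t)) (i : Fin 3) {a b a' b' : Fin (k + 1) × Fin n}
    (h : unravelAdj M a b i) (h' : unravelAdj M a' b' i) : a = a' ↔ b = b' := by
  obtain ⟨t, x⟩ := a
  obtain ⟨u, y⟩ := b
  obtain ⟨t', x'⟩ := a'
  obtain ⟨u', y'⟩ := b'
  fin_cases i
  · obtain ⟨rfl, rfl⟩ : t = u ∧ x = y := h
    obtain ⟨rfl, rfl⟩ : t' = u' ∧ x' = y' := h'
    rfl
  · obtain ⟨rfl, rfl⟩ : t = u + 1 ∧ x = y := h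
    obtain ⟨rfl, rfl⟩ : t' = u' + 1 ∧ x' = y' := h'
    simp
  · obtain ⟨rfl, hm⟩ : t = u ∧ (x, y) ∈ M t := h
    obtain ⟨rfl, hm'⟩ : t' = u' ∧ (x', y') ∈ M t' := h'
    simp only [Prod.mk.injEq]
    refine and_congr_right ?_
    rintro rfl
    have := (hM t).1 _ hm _ hm'
    grind

lemma unravelAdj_not_cross {n k : ℕ} {M : Fin (k + 1) → Finset (Fin n × Fin n)}
    (hM : ∀ t, MonotoneMatching (M t)) (i : Fin 3) {a b a' b' : Fin (k + 1) × Fin n}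
    (h : unravelAdj M a b i) (h' : unravelAdj M a' b' i) :
    ¬CrossNat (unravelPos (.inl a)) (unravelPos (.inr b))
      (unravelPos (.inl a')) (unravelPos (.inr b')) := by
  obtain ⟨t, x⟩ := a
  obtain ⟨u, y⟩ := b
  obtain ⟨t', x'⟩ := a'
  obtain ⟨u', y'⟩ := b'
  simp only [unravelPos, CrossNat]
  fin_cases i
  · obtain ⟨rfl, rfl⟩ : t = u ∧ x = y := h
    obtain ⟨rfl, rfl⟩ : t' = u' ∧ x' = y' := h'
    rcases lt_trichotomy t t' with htu | rfl | htu
    · have := mul_add_le_of_lt (n := n) htu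
      omega
    · omega
    · have := mul_add_le_of_lt (n := n) htu
      omega
  · obtain ⟨ht, rfl⟩ : t = u + 1 ∧ x = y := h
    obtain ⟨ht', rfl⟩ : t' = u' + 1 ∧ x' = y' := h'
    have hval : ∀ {t u : Fin (k + 1)}, t = u + 1 → ((t : ℕ) * n = 0 ∧ u = Fin.last k) ∨
        (t : ℕ) * n = u * n + n := by
      rintro t u rfl
      rw [Fin.val_add_one]
      split_ifs with hu
      · simp [hu]
      · right
        ring
    have hv := hval ht
    have hv' := hval ht'
    rcases lt_trichotomy u u' with htu | rfl | htu
    · have := mul_add_le_of_lt (n := n) htu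
      have := Fin.ne_last_of_lt htu
      omega
    · obtain rfl : t = t' := ht.trans ht'.symm
      omega
    · have := mul_add_le_of_lt (n := n) htu
      have := Fin.ne_last_of_lt htu
      omega
  · obtain ⟨rfl, hm⟩ : t = u ∧ (x, y) ∈ M t := h
    obtain ⟨rfl, hm'⟩ : t' = u' ∧ (x', y') ∈ M t' := h'
    rcases lt_trichotomy t t' with htu | rfl | htu
    · have := mul_add_le_of_lt (n := n) htu
      omega
    · have h1 := (hM t).2 _ hm _ hm'
      have h2 := (hM t).2 _ hm' _ hm
      simp only [Fin.lt_def] at h1 h2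
      omega
    · have := mul_add_le_of_lt (n := n) htu
      omega

lemma unravel_hasPushdownEmbedding {n k : ℕ} {M : Fin (k + 1) → Finset (Fin n × Fin n)}
    (hM : ∀ t, MonotoneMatching (M t)) :
    HasPushdownEmbedding (Finset.univ.biUnion (unravelPage M)) 3 := by
  refine hasPushdownEmbedding_biUnion
    (fun v => unravelPos (Sum.map finProdFinEquiv.symm finProdFinEquiv.symm v))
    (unravelPos_injective.comp (finProdFinEquiv.symm.injective.sumMap
      finProdFinEquiv.symm.injective)) _ (fun i e he f hf hne => ?_) (fun i e he f hf => ?_)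
  all_goals
    have he' := mem_unravelPage.mp he
    have hf' := mem_unravelPage.mp hf
  · have hiff := unravelAdj_matching hM i he' hf'
    rw [EmbeddingLike.apply_eq_iff_eq, EmbeddingLike.apply_eq_iff_eq] at hiff
    exact ⟨fun h => hne (Prod.ext h (hiff.mp h)), fun h => hne (Prod.ext (hiff.mpr h) h)⟩
  · exact unravelAdj_not_cross hM i he' hf'

lemma unravel_bipExpander {n k : ℕ} {ε : ℝ} (hε0 : 0 < ε) (hε1 : ε ≤ 1)
    {M : Fin (k + 1) → Finset (Fin n × Fin n)} (hM : ∀ t, MonotoneMatching (M t))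
    (hE : BipExpander (Finset.univ.biUnion M) ε) :
    BipExpander (Finset.univ.biUnion (unravelPage M)) (ε / (2 * (k + 1) * (k + 2))) := by
  intro S hS
  have hmem : ∀ (i : Fin 3) {t u : Fin (k + 1)} {x y : Fin n}, finProdFinEquiv (t, x) ∈ S →
      unravelAdj M (t, x) (u, y) i →
      finProdFinEquiv (u, y) ∈ nbhdA (Finset.univ.biUnion (unravelPage M)) S := by
    intro i t u x y hx hadj
    refine Finset.mem_image.mpr ⟨(finProdFinEquiv (t, x), finProdFinEquiv (u, y)),
      Finset.mem_filter.mpr ⟨Finset.mem_biUnion.mpr ⟨i, Finset.mem_univ _,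
        mem_unravelPage.mpr ?_⟩, hx⟩, rfl⟩
    simpa only [Equiv.symm_apply_apply] using hadj
  rw [card_eq_sum_card_slice S] at hS ⊢
  rw [card_eq_sum_card_slice (nbhdA _ _)]
  refine cyclic_expansion hε0 hε1 M (fun t => (hM t).1) hE _ _ (fun t x hx => ?_)
    (fun t x hx => ?_) (fun t y hy => ?_) (by exact_mod_cast hS)
  · exact Finset.mem_filter.mpr ⟨Finset.mem_univ _,
      hmem 0 (Finset.mem_filter.mp hx).2 ⟨rfl, rfl⟩⟩
  · exact Finset.mem_filter.mpr ⟨Finset.mem_univ _,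
      hmem 1 (Finset.mem_filter.mp hx).2 ⟨rfl, rfl⟩⟩
  · obtain ⟨⟨x, y'⟩, he, rfl⟩ := Finset.mem_image.mp hy
    obtain ⟨hm, hx⟩ := Finset.mem_filter.mp he
    exact Finset.mem_filter.mpr ⟨Finset.mem_univ _,
      hmem 2 (Finset.mem_filter.mp hx).2 ⟨rfl, hm⟩⟩

/-- If there is an infinite family of `d`-monotone bipartite `ε`-expanders, then there
is an infinite family of bipartite `ε'`-expanders admitting 3-pushdown book
embeddings, for some `ε' > 0`. -/
theorem stmt13 (ε : ℝ) (hε0 : 0 < ε) (hε1 : ε ≤ 1) (d : ℕ) (hd : 1 ≤ d)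
    (h : ∀ N : ℕ, ∃ n : ℕ, N < 2 * n ∧ ∃ E : Finset (Fin n × Fin n),
      IsMonotoneGraph E d ∧ BipExpander E ε) :
    ∃ ε' : ℝ, 0 < ε' ∧ ∀ N : ℕ, ∃ n : ℕ, N < 2 * n ∧
      ∃ E : Finset (Fin n × Fin n), BipExpander E ε' ∧ HasPushdownEmbedding E 3 := by
  obtain ⟨k, rfl⟩ : ∃ k, d = k + 1 := ⟨d - 1, by omega⟩
  refine ⟨ε / (2 * (k + 1) * (k + 2)), by positivity, fun N => ?_⟩
  obtain ⟨n, hn, _, ⟨M, hM, rfl⟩, hE⟩ := h N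
  exact ⟨(k + 1) * n, by nlinarith, _, unravel_bipExpander hε0 hε1 hM hE,
    unravel_hasPushdownEmbedding hM⟩
end

section
/- Suppose that there exist ε ∈ (0,1] and an integer d ≥ 1 such that for every N ∈ ℕ there is a finite d-monotone bipartite ε-expander with more than N vertices. Then there exists ε' > 0 such that for every N ∈ ℕ there is a finite bipartite ε'-expander with more than N vertices that has maximum degree at most 3 and admits a 4-track layout. -/
/-- The graph with edge set `E` has maximum degree at most `D`. -/
def MaxDegreeLe {n m : ℕ} (E : Finset (Fin n × Fin m)) (D : ℕ) : Prop :=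
  (∀ i : Fin n, (E.filter (fun e => e.1 = i)).card ≤ D) ∧
  (∀ j : Fin m, (E.filter (fun e => e.2 = j)).card ≤ D)

/-- The adjacency relation on the vertex set `Fin n ⊕ Fin m` of the bipartite graph
with edge set `E`. -/
def AdjE {n m : ℕ} (E : Finset (Fin n × Fin m)) :
    (Fin n ⊕ Fin m) → (Fin n ⊕ Fin m) → Prop
  | .inl i, .inr j => (i, j) ∈ E
  | .inr j, .inl i => (i, j) ∈ E
  | _, _ => False

/-- A `p`-track layout of the bipartite graph with edge set `E`: an assignment `τ` of
the vertices to `p` tracks, each track being an independent set totally ordered by a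
global order `σ` (an injection into `ℕ`), such that no two edges between the same pair
of tracks cross. -/
def HasTrackLayout {n m : ℕ} (E : Finset (Fin n × Fin m)) (p : ℕ) : Prop :=
  ∃ τ : (Fin n ⊕ Fin m) → Fin p, ∃ σ : (Fin n ⊕ Fin m) → ℕ,
    Function.Injective σ ∧
    (∀ u v, AdjE E u v → τ u ≠ τ v) ∧
    (∀ v w x y, AdjE E v w → AdjE E x y → τ v = τ x → τ w = τ y →
      ¬(σ v < σ x ∧ σ y < σ w))

/-- The two bipartite layers `A i`, `B i` (`i < k`), each a copy of `Fin n`, are joined by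
`M i`; consecutive layers `A i`, `B (i+1)` and `A (i+1)`, `B i` are joined by the identity. -/
def LadderAdj {k n : ℕ} (M : Fin k → Finset (Fin n × Fin n)) (p q : Fin k × Fin n) : Prop :=
  (q.1 = p.1 ∧ (p.2, q.2) ∈ M p.1) ∨
    (p.2 = q.2 ∧ ((q.1 : ℕ) = p.1 + 1 ∨ (p.1 : ℕ) = q.1 + 1))

open Classical in
/-- The ladder graph of `M`, with the layers listed lexicographically. -/
noncomputable def ladder {k n : ℕ} (M : Fin k → Finset (Fin n × Fin n)) :
    Finset (Fin (k * n) × Fin (k * n)) :=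
  Finset.univ.filter fun e => LadderAdj M (finProdFinEquiv.symm e.1) (finProdFinEquiv.symm e.2)

lemma mem_ladder {k n : ℕ} (M : Fin k → Finset (Fin n × Fin n)) (e) :
    e ∈ ladder M ↔ LadderAdj M (finProdFinEquiv.symm e.1) (finProdFinEquiv.symm e.2) := by
  simp [ladder]

lemma lt_iff_finProdFinEquiv_symm_lex {k n : ℕ} (a b : Fin (k * n)) :
    a < b ↔ (finProdFinEquiv.symm a).1 < (finProdFinEquiv.symm b).1 ∨
      ((finProdFinEquiv.symm a).1 = (finProdFinEquiv.symm b).1 ∧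
        (finProdFinEquiv.symm a).2 < (finProdFinEquiv.symm b).2) := by
  obtain ⟨⟨i, x⟩, rfl⟩ := finProdFinEquiv.surjective a
  obtain ⟨⟨j, y⟩, rfl⟩ := finProdFinEquiv.surjective b
  simp only [Equiv.symm_apply_apply, Fin.lt_def, Fin.ext_iff, finProdFinEquiv_apply_val]
  have hx := x.2
  have hy := y.2
  rcases lt_trichotomy (i : ℕ) j with h | h | h
  · have : n * (i + 1) ≤ n * j := Nat.mul_le_mul_left n h
    rw [mul_add] at this
    omega
  · rw [h]; omega
  · have : n * (j + 1) ≤ n * i := Nat.mul_le_mul_left n h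
    rw [mul_add] at this
    omega

lemma MonotoneMatching.fst_eq_iff {n m : ℕ} {M : Finset (Fin n × Fin m)}
    (hM : MonotoneMatching M) {a b : Fin n} {c d : Fin m} (h : (a, c) ∈ M) (h' : (b, d) ∈ M) :
    a = b ↔ c = d := by
  by_cases he : (a, c) = (b, d)
  · simp_all
  · have := hM.1 _ h _ h' he
    simp_all

lemma ladder_maxDegreeLe {k n : ℕ} {M : Fin k → Finset (Fin n × Fin n)}
    (hM : ∀ i, MonotoneMatching (M i)) : MaxDegreeLe (ladder M) 3 := by
  constructor
  · intro a
    have hcard : (Finset.Icc ((finProdFinEquiv.symm a).1 : ℕ)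
        ((finProdFinEquiv.symm a).1 + 2)).card = 3 := by
      rw [Nat.card_Icc]
      omega
    rw [← hcard]
    refine Finset.card_le_card_of_injOn
      (fun e => ((finProdFinEquiv.symm e.2).1 : ℕ) + 1) ?_ ?_
    · rintro ⟨b, c⟩ he
      simp only [Finset.coe_filter, Set.mem_ofPred_eq, mem_ladder, LadderAdj, Fin.ext_iff] at he
      obtain ⟨he, hb⟩ := he
      obtain rfl : b = a := Fin.ext hb
      simp only [Finset.coe_Icc, Set.mem_Icc]
      omega
    · rintro ⟨b, c⟩ he ⟨b', c'⟩ he' heq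
      simp only [Finset.coe_filter, Set.mem_ofPred_eq, mem_ladder] at he he' heq
      obtain ⟨he, rfl⟩ := he
      obtain ⟨he', rfl⟩ := he'
      have h1 : (finProdFinEquiv.symm c).1 = (finProdFinEquiv.symm c').1 := Fin.ext (by omega)
      have h2 : (finProdFinEquiv.symm c).2 = (finProdFinEquiv.symm c').2 := by
        rcases he with ⟨hi, hm⟩ | ⟨hi, hm⟩ <;> rcases he' with ⟨hi', hm'⟩ | ⟨hi', hm'⟩
        · exact ((hM _).fst_eq_iff hm hm').1 rfl
        · rw [Fin.ext_iff] at hi h1; omega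
        · rw [Fin.ext_iff] at hi' h1; omega
        · exact hi.symm.trans hi'
      have : c = c' := finProdFinEquiv.symm.injective (Prod.ext h1 h2)
      rw [this]
  · intro a
    have hcard : (Finset.Icc ((finProdFinEquiv.symm a).1 : ℕ)
        ((finProdFinEquiv.symm a).1 + 2)).card = 3 := by
      rw [Nat.card_Icc]
      omega
    rw [← hcard]
    refine Finset.card_le_card_of_injOn
      (fun e => ((finProdFinEquiv.symm e.1).1 : ℕ) + 1) ?_ ?_
    · rintro ⟨c, b⟩ he
      simp only [Finset.coe_filter, Set.mem_ofPred_eq, mem_ladder, LadderAdj, Fin.ext_iff] at he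
      obtain ⟨he, hb⟩ := he
      obtain rfl : b = a := Fin.ext hb
      simp only [Finset.coe_Icc, Set.mem_Icc]
      omega
    · rintro ⟨c, b⟩ he ⟨c', b'⟩ he' heq
      simp only [Finset.coe_filter, Set.mem_ofPred_eq, mem_ladder] at he he' heq
      obtain ⟨he, rfl⟩ := he
      obtain ⟨he', rfl⟩ := he'
      have h1 : (finProdFinEquiv.symm c).1 = (finProdFinEquiv.symm c').1 := Fin.ext (by omega)
      have h2 : (finProdFinEquiv.symm c).2 = (finProdFinEquiv.symm c').2 := by
        rcases he with ⟨hi, hm⟩ | ⟨hi, hm⟩ <;> rcases he' with ⟨hi', hm'⟩ | ⟨hi', hm'⟩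
        · rw [h1] at hm
          exact ((hM _).fst_eq_iff hm hm').2 rfl
        · rw [Fin.ext_iff] at hi h1; omega
        · rw [Fin.ext_iff] at hi' h1; omega
        · exact hi.trans hi'.symm
      have : c = c' := finProdFinEquiv.symm.injective (Prod.ext h1 h2)
      rw [this]

lemma ladder_not_cross {k n : ℕ} {M : Fin k → Finset (Fin n × Fin n)}
    (hM : ∀ i, MonotoneMatching (M i)) {a b a' b' : Fin (k * n)}
    (h : (a, b) ∈ ladder M) (h' : (a', b') ∈ ladder M)
    (ha : ((finProdFinEquiv.symm a).1 : ℕ) % 4 = ((finProdFinEquiv.symm a').1 : ℕ) % 4)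
    (hb : ((finProdFinEquiv.symm b).1 : ℕ) % 4 = ((finProdFinEquiv.symm b').1 : ℕ) % 4) :
    ¬(a < a' ∧ b' < b) := by
  rw [mem_ladder] at h h'
  rw [lt_iff_finProdFinEquiv_symm_lex, lt_iff_finProdFinEquiv_symm_lex]
  generalize finProdFinEquiv.symm a = p at *
  generalize finProdFinEquiv.symm b = q at *
  generalize finProdFinEquiv.symm a' = p' at *
  generalize finProdFinEquiv.symm b' = q' at *
  obtain ⟨i, x⟩ := p
  obtain ⟨j, y⟩ := q
  obtain ⟨i', x'⟩ := p'
  obtain ⟨j', y'⟩ := q'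
  simp only [LadderAdj] at *
  rcases h with ⟨rfl, hm⟩ | ⟨rfl, hm⟩ <;> rcases h' with ⟨rfl, hm'⟩ | ⟨rfl, hm'⟩
  · rintro ⟨h1 | ⟨rfl, h1⟩, h2 | ⟨h2, h3⟩⟩
    · omega
    · omega
    · omega
    · exact (hM _).2 _ hm _ hm' ⟨h1, h3⟩
  all_goals simp only [Fin.lt_def, Fin.ext_iff] at *
  all_goals omega

lemma ladder_layer_dist {k n : ℕ} {M : Fin k → Finset (Fin n × Fin n)} {a b : Fin (k * n)}
    (h : (a, b) ∈ ladder M) :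
    ((finProdFinEquiv.symm a).1 : ℕ) ≤ (finProdFinEquiv.symm b).1 + 1 ∧
      ((finProdFinEquiv.symm b).1 : ℕ) ≤ (finProdFinEquiv.symm a).1 + 1 := by
  simp only [mem_ladder, LadderAdj, Fin.ext_iff] at h
  omega

lemma layer_le_of_le {k n : ℕ} {a b : Fin (k * n)} (h : (a : ℕ) ≤ b) :
    ((finProdFinEquiv.symm a).1 : ℕ) ≤ (finProdFinEquiv.symm b).1 := by
  rcases h.eq_or_lt with h | h
  · rw [Fin.ext h]
  · have := (lt_iff_finProdFinEquiv_symm_lex a b).1 h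
    simp only [Fin.lt_def, Fin.ext_iff] at this
    omega

lemma ladder_hasTrackLayout {k n : ℕ} {M : Fin k → Finset (Fin n × Fin n)}
    (hM : ∀ i, MonotoneMatching (M i)) : HasTrackLayout (ladder M) 4 := by
  refine ⟨Sum.elim (fun a => ⟨3 * (finProdFinEquiv.symm a).1 % 4, Nat.mod_lt _ (by norm_num)⟩)
    (fun b => ⟨(3 * (finProdFinEquiv.symm b).1 + 2) % 4, Nat.mod_lt _ (by norm_num)⟩),
    Sum.elim (fun a => 2 * a) (fun b => 2 * b + 1), ?_, ?_, ?_⟩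
  · rintro (a | a) (b | b) h <;> simp only [Sum.elim_inl, Sum.elim_inr] at h
    · rw [Fin.ext (show (a : ℕ) = b by omega)]
    · omega
    · omega
    · rw [Fin.ext (show (a : ℕ) = b by omega)]
  · rintro (a | a) (b | b) h <;> simp only [AdjE] at h <;>
      simp only [Sum.elim_inl, Sum.elim_inr, ne_eq, Fin.ext_iff] <;>
      have := ladder_layer_dist h <;> omega
  · rintro (v | v) (w | w) (x | x) (y | y) h h' h1 h2 <;> simp only [AdjE] at h h' <;>
      simp only [Sum.elim_inl, Sum.elim_inr, Fin.ext_iff] at h1 h2 ⊢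
    · have := ladder_not_cross hM h h' (by omega) (by omega)
      simp only [Fin.lt_def] at this
      omega
    · rintro ⟨h3, h4⟩
      have h5 := layer_le_of_le (show (v : ℕ) ≤ x by omega)
      have h6 := layer_le_of_le (show (y : ℕ) ≤ w by omega)
      have := ladder_layer_dist h
      have := ladder_layer_dist h'
      omega
    · rintro ⟨h3, h4⟩
      have h5 := layer_le_of_le (show (v : ℕ) ≤ x by omega)
      have h6 := layer_le_of_le (show (y : ℕ) ≤ w by omega)
      have := ladder_layer_dist h
      have := ladder_layer_dist h'
      omega
    · have := ladder_not_cross hM h' h (by omega) (by omega)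
      simp only [Fin.lt_def] at this
      omega

/-- Adjacency in the cycle through all `2k` layers: the two rails of the ladder, closed up by
the first and the last rung. -/
def FoldedCycleAdj {k : ℕ} (i j : Fin k) : Prop :=
  (j : ℕ) = i + 1 ∨ (i : ℕ) = j + 1 ∨ (i = j ∧ ((i : ℕ) = 0 ∨ (i : ℕ) + 1 = k))

/-- The perfect matching of the folded cycle going up from layers of parity `r` and down from
the others. -/
def foldedMatching (k r : ℕ) (i : Fin k) : Fin k :=
  if h : (i : ℕ) % 2 = r ∧ (i : ℕ) + 1 < k then ⟨i + 1, h.2⟩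
  else if (i : ℕ) % 2 = r then i else ⟨i - 1, by omega⟩

lemma foldedMatching_val (k r : ℕ) (i : Fin k) : (foldedMatching k r i : ℕ) =
    if (i : ℕ) % 2 = r then (if (i : ℕ) + 1 < k then (i : ℕ) + 1 else i) else i - 1 := by
  unfold foldedMatching
  split_ifs <;> simp_all

lemma foldedMatching_injective {k r : ℕ} (hr : r < 2) :
    Function.Injective (foldedMatching k r) := by
  intro i j h
  rw [Fin.ext_iff, foldedMatching_val, foldedMatching_val] at h
  apply Fin.ext
  split_ifs at h <;> omega

lemma foldedCycleAdj_foldedMatching {k : ℕ} (r : ℕ) (i : Fin k) :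
    FoldedCycleAdj i (foldedMatching k r i) := by
  have := i.2
  simp only [FoldedCycleAdj, Fin.ext_iff, foldedMatching_val]
  split_ifs <;> omega

lemma FoldedCycleAdj.exists_foldedMatching_eq {k : ℕ} {i j : Fin k} (h : FoldedCycleAdj i j) :
    ∃ r, r < 2 ∧ foldedMatching k r i = j := by
  have := i.2
  have := j.2
  simp only [FoldedCycleAdj, Fin.ext_iff, foldedMatching_val] at h ⊢
  by_cases hu : (j : ℕ) = i + 1 ∨ (i = j ∧ (i : ℕ) + 1 = k)
  · refine ⟨i % 2, by omega, ?_⟩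
    split_ifs <;> omega
  · refine ⟨(i + 1) % 2, by omega, ?_⟩
    split_ifs <;> omega

/-- A set of layers has at least as many neighbours in the folded cycle, and strictly more
unless it is empty or everything. -/
lemma card_le_foldedCycle_nbhd {k : ℕ} {S T : Finset (Fin k)}
    (hT : ∀ i ∈ S, ∀ j, FoldedCycleAdj i j → j ∈ T) :
    S.card ≤ T.card ∧ (S.Nonempty → S ≠ Finset.univ → S.card + 1 ≤ T.card) := by
  have hsub : ∀ r, S.image (foldedMatching k r) ⊆ T := by
    intro r j hj
    obtain ⟨i, hi, rfl⟩ := Finset.mem_image.1 hj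
    exact hT i hi _ (foldedCycleAdj_foldedMatching r i)
  have hcard : ∀ r < 2, (S.image (foldedMatching k r)).card = S.card := fun _ hr =>
    Finset.card_image_of_injective _ (foldedMatching_injective hr)
  have hle : S.card ≤ T.card := hcard 0 (by norm_num) ▸ Finset.card_le_card (hsub 0)
  refine ⟨hle, fun hne hun => ?_⟩
  by_contra hlt
  have heq : ∀ r < 2, S.image (foldedMatching k r) = T := fun r hr =>
    Finset.eq_of_subset_of_card_le (hsub r) (by rw [hcard r hr]; omega)
  have hclosed : ∀ i ∈ S, ∀ j i', FoldedCycleAdj i j → FoldedCycleAdj i' j → i' ∈ S := by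
    intro i hi j i' hij hij'
    obtain ⟨r, hr, rfl⟩ := hij'.exists_foldedMatching_eq
    have := hT i hi _ hij
    rw [← heq r hr] at this
    exact (foldedMatching_injective hr).mem_finset_image.1 this
  have hdown : ∀ m (hm : m < k), ⟨m, hm⟩ ∈ S → ∃ h0 : 0 < k, ⟨0, h0⟩ ∈ S := by
    intro m
    induction m using Nat.strong_induction_on with
    | _ m ih =>
      intro hm hS
      rcases Nat.lt_or_ge m 2 with h2 | h2
      · refine ⟨by omega, hclosed _ hS ⟨0, by omega⟩ _ ?_ ?_⟩ <;>
          simp [FoldedCycleAdj, Fin.ext_iff] <;> omega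
      · refine ih (m - 2) (by omega) (by omega) (hclosed _ hS ⟨m - 1, by omega⟩ _ ?_ ?_) <;>
          simp only [FoldedCycleAdj, Fin.ext_iff] <;> omega
  obtain ⟨i, hi⟩ := hne
  obtain ⟨h0, hS0⟩ := hdown i i.2 hi
  have hup : ∀ m (hm : m < k), ⟨m, hm⟩ ∈ S := by
    intro m
    induction m using Nat.strong_induction_on with
    | _ m ih =>
      intro hm
      rcases Nat.lt_or_ge m 2 with h2 | h2
      · refine hclosed _ hS0 ⟨0, by omega⟩ _ ?_ ?_ <;>
          simp [FoldedCycleAdj, Fin.ext_iff] <;> omega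
      · refine hclosed _ (ih (m - 2) (by omega) (by omega)) ⟨m - 1, by omega⟩ _ ?_ ?_ <;>
          simp only [FoldedCycleAdj, Fin.ext_iff] <;> omega
  exact hun (Finset.eq_univ_iff_forall.2 fun i => hup i i.2)

lemma card_eq_sum_card_fiber {k n : ℕ} (S : Finset (Fin (k * n))) :
    S.card = ∑ x : Fin n,
      (Finset.univ.filter fun i : Fin k => finProdFinEquiv (i, x) ∈ S).card := by
  rw [Finset.card_eq_sum_card_fiberwise (f := fun a => (finProdFinEquiv.symm a).2)
    (t := Finset.univ) (fun _ _ => Finset.mem_coe.2 (Finset.mem_univ _))]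
  refine Finset.sum_congr rfl fun x _ => ?_
  refine Finset.card_bij' (fun a _ => (finProdFinEquiv.symm a).1)
    (fun i _ => finProdFinEquiv (i, x)) ?_ ?_ ?_ ?_
  · intro a ha
    obtain ⟨ha, rfl⟩ := Finset.mem_filter.1 ha
    simpa only [Finset.mem_filter, Finset.mem_univ, true_and, Prod.mk.eta,
      Equiv.apply_symm_apply, and_true] using ha
  · intro i hi
    simpa only [Finset.mem_filter, Finset.mem_univ, true_and, Equiv.symm_apply_apply,
      and_true] using hi
  · intro a ha
    obtain ⟨ha, rfl⟩ := Finset.mem_filter.1 ha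
    simp only [Prod.mk.eta, Equiv.apply_symm_apply]
  · intro i hi
    simp only [Equiv.symm_apply_apply]

lemma mem_nbhdA {n m : ℕ} {E : Finset (Fin n × Fin m)} {S : Finset (Fin n)} {y : Fin m} :
    y ∈ nbhdA E S ↔ ∃ x ∈ S, (x, y) ∈ E := by
  simp [nbhdA, and_comm]

lemma ladder_bipExpander {k n : ℕ} (hk : 0 < k) {M : Fin k → Finset (Fin n × Fin n)}
    {E : Finset (Fin n × Fin n)} {ε : ℝ} (hε0 : 0 < ε) (hε1 : ε ≤ 1) (hE : BipExpander E ε)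
    (hEM : ∀ e ∈ E, ∃ i, e ∈ M i)
    (hdiag : ∀ (i : Fin k) (x : Fin n), (i : ℕ) = 0 ∨ (i : ℕ) + 1 = k → (x, x) ∈ M i) :
    BipExpander (ladder M) (ε / (2 * k)) := by
  intro S hS
  set T := nbhdA (ladder M) S with hT
  let s : Fin n → Finset (Fin k) := fun x =>
    Finset.univ.filter fun i => finProdFinEquiv (i, x) ∈ S
  let t : Fin n → Finset (Fin k) := fun x =>
    Finset.univ.filter fun i => finProdFinEquiv (i, x) ∈ T
  have hScard : S.card = ∑ x, (s x).card := card_eq_sum_card_fiber S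
  have hTcard : T.card = ∑ x, (t x).card := card_eq_sum_card_fiber T
  have hst : ∀ x, (s x).card ≤ (t x).card ∧
      ((s x).Nonempty → s x ≠ Finset.univ → (s x).card + 1 ≤ (t x).card) := by
    intro x
    refine card_le_foldedCycle_nbhd fun i hi j hij => ?_
    refine Finset.mem_filter.2 ⟨Finset.mem_univ _, ?_⟩
    rw [hT, mem_nbhdA]
    refine ⟨_, (Finset.mem_filter.1 hi).2, ?_⟩
    simp only [mem_ladder, Equiv.symm_apply_apply, LadderAdj]
    rcases hij with h | h | ⟨rfl, h⟩
    · exact Or.inr ⟨trivial, Or.inl h⟩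
    · exact Or.inr ⟨trivial, Or.inr h⟩
    · exact Or.inl ⟨rfl, hdiag _ _ h⟩
  set F := Finset.univ.filter fun x => s x = Finset.univ with hF
  set D := Finset.univ.filter fun x => (s x).card + 1 ≤ (t x).card with hD
  have hFS : k * F.card ≤ S.card := by
    rw [hScard]
    calc k * F.card = ∑ x ∈ F, (s x).card := by
          rw [Finset.sum_congr rfl fun x hx => by rw [(Finset.mem_filter.1 hx).2]]
          simp [mul_comm]
      _ ≤ _ := Finset.sum_le_sum_of_subset (Finset.subset_univ _)
  have hk' : (0 : ℝ) < k := by exact_mod_cast hk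
  have hFn : (F.card : ℝ) ≤ n / 2 := by
    have h1 : (k : ℝ) * F.card ≤ S.card := by exact_mod_cast hFS
    push_cast at hS
    have h2 : (k : ℝ) * F.card ≤ k * (n / 2) := by linarith
    exact le_of_mul_le_mul_left h2 hk'
  have hNF := hE F hFn
  have hNsub : nbhdA E F ⊆ F ∪ D := by
    intro y hy
    obtain ⟨x, hx, hxy⟩ := mem_nbhdA.1 hy
    by_cases hyF : y ∈ F
    · exact Finset.mem_union_left _ hyF
    refine Finset.mem_union_right _ (Finset.mem_filter.2 ⟨Finset.mem_univ _, ?_⟩)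
    have hyu : s y ≠ Finset.univ := fun h => hyF (Finset.mem_filter.2 ⟨Finset.mem_univ _, h⟩)
    rcases (s y).eq_empty_or_nonempty with h0 | h0
    · rw [h0, Finset.card_empty, zero_add, Nat.one_le_iff_ne_zero, ← Nat.pos_iff_ne_zero,
        Finset.card_pos]
      obtain ⟨i, hi⟩ := hEM _ hxy
      refine ⟨i, Finset.mem_filter.2 ⟨Finset.mem_univ _,
        mem_nbhdA.2 ⟨finProdFinEquiv (i, x), ?_, ?_⟩⟩⟩
      · have : i ∈ s x := by rw [(Finset.mem_filter.1 hx).2]; exact Finset.mem_univ _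
        exact (Finset.mem_filter.1 this).2
      · simp only [mem_ladder, Equiv.symm_apply_apply, LadderAdj]
        exact Or.inl ⟨trivial, hi⟩
    · exact (hst y).2 h0 hyu
  have hFD : ε * F.card ≤ D.card := by
    have h1 : ((nbhdA E F).card : ℝ) ≤ F.card + D.card := by
      exact_mod_cast (Finset.card_le_card hNsub).trans (Finset.card_union_le _ _)
    linarith
  have hSle : S.card ≤ k * (F.card + D.card) := by
    have hsupp : ∀ x, x ∉ F ∪ D → (s x).card = 0 := by
      intro x hx
      simp only [Finset.mem_union, not_or, hF, hD, Finset.mem_filter, Finset.mem_univ,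
        true_and] at hx
      by_contra h
      exact hx.2 ((hst x).2 (Finset.card_pos.1 (Nat.pos_of_ne_zero h)) hx.1)
    calc S.card = ∑ x ∈ F ∪ D, (s x).card := by
          rw [hScard]
          exact (Finset.sum_subset (Finset.subset_univ _) fun x _ hx => hsupp x hx).symm
      _ ≤ (F ∪ D).card * k := by
          rw [← smul_eq_mul]
          exact Finset.sum_le_card_nsmul _ _ _ fun x _ =>
            (Finset.card_le_univ _).trans (Fintype.card_fin k).le
      _ ≤ (F.card + D.card) * k := Nat.mul_le_mul_right _ (Finset.card_union_le _ _)
      _ = _ := mul_comm _ _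
  have hTge : S.card + D.card ≤ T.card := by
    rw [hScard, hTcard, hD, Finset.card_filter, ← Finset.sum_add_distrib]
    refine Finset.sum_le_sum fun x _ => ?_
    have := (hst x).1
    split_ifs <;> omega
  have hS' : (S.card : ℝ) ≤ k * (F.card + D.card) := by exact_mod_cast hSle
  have hT' : (S.card : ℝ) + D.card ≤ T.card := by exact_mod_cast hTge
  have hmain : ε / (2 * k) * S.card ≤ D.card := by
    rw [div_mul_eq_mul_div, div_le_iff₀ (by positivity)]
    have h1 : ε * S.card ≤ ε * (k * (F.card + D.card)) := mul_le_mul_of_nonneg_left hS' hε0.le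
    have h2 : (k : ℝ) * (ε * F.card) ≤ k * D.card := mul_le_mul_of_nonneg_left hFD hk'.le
    have h3 : ε * (k * (D.card : ℝ)) ≤ 1 * (k * D.card) :=
      mul_le_mul_of_nonneg_right hε1 (by positivity)
    linarith
  linarith

lemma monotoneMatching_diag (n : ℕ) :
    MonotoneMatching (Finset.univ.image fun x : Fin n => (x, x)) := by
  constructor
  · intro e he f hf hne
    obtain ⟨x, -, rfl⟩ := Finset.mem_image.1 he
    obtain ⟨y, -, rfl⟩ := Finset.mem_image.1 hf
    simpa using hne
  · intro e he f hf h
    obtain ⟨x, -, rfl⟩ := Finset.mem_image.1 he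
    obtain ⟨y, -, rfl⟩ := Finset.mem_image.1 hf
    exact lt_asymm h.1 h.2

/-- If there is an infinite family of `d`-monotone bipartite `ε`-expanders, then there
is an infinite family of bipartite `ε'`-expanders with maximum degree at most `3`
admitting 4-track layouts, for some `ε' > 0`. -/
theorem stmt15 (ε : ℝ) (hε0 : 0 < ε) (hε1 : ε ≤ 1) (d : ℕ) (hd : 1 ≤ d)
    (h : ∀ N : ℕ, ∃ n : ℕ, N < 2 * n ∧ ∃ E : Finset (Fin n × Fin n),
      IsMonotoneGraph E d ∧ BipExpander E ε) :
    ∃ ε' : ℝ, 0 < ε' ∧ ∀ N : ℕ, ∃ n : ℕ, N < 2 * n ∧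
      ∃ E : Finset (Fin n × Fin n), BipExpander E ε' ∧ MaxDegreeLe E 3 ∧
        HasTrackLayout E 4 := by
  refine ⟨ε / (2 * ((d + 2 : ℕ) : ℝ)), by positivity, fun N => ?_⟩
  obtain ⟨n, hn, E, ⟨M, hM, rfl⟩, hE⟩ := h N
  let M' : Fin (d + 2) → Finset (Fin n × Fin n) := fun i =>
    if hi : 0 < (i : ℕ) ∧ (i : ℕ) < d + 1 then M ⟨i - 1, by omega⟩
    else Finset.univ.image fun x => (x, x)
  have hM' : ∀ i, MonotoneMatching (M' i) := by
    intro i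
    simp only [M']
    split_ifs
    · exact hM _
    · exact monotoneMatching_diag n
  refine ⟨(d + 2) * n, by nlinarith, ladder M', ?_, ladder_maxDegreeLe hM',
    ladder_hasTrackLayout hM'⟩
  refine ladder_bipExpander (by omega) hε0 hε1 hE ?_ ?_
  · intro e he
    obtain ⟨t, -, ht⟩ := Finset.mem_biUnion.1 he
    refine ⟨⟨t + 1, by omega⟩, ?_⟩
    have hpos : 0 < (t : ℕ) + 1 ∧ (t : ℕ) + 1 < d + 1 := by omega
    simpa only [M', dif_pos hpos, Nat.add_sub_cancel] using ht
  · intro i x hi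
    have : ¬(0 < (i : ℕ) ∧ (i : ℕ) < d + 1) := by omega
    simp only [M', dif_neg this]
    exact Finset.mem_image_of_mem _ (Finset.mem_univ x)
end

section
/- Let ε ∈ (0,1] and let G be a bipartite ε-expander with bipartition (A,B), where n := |A| = |B|, so G has 2n vertices. Then every separator Z of G satisfies |Z| ≥ (ε/2)(n − 1) − 1. -/
/-- `G` with bipartition `(A,B)` is a bipartite `ε`-expander: `|A| = |B|` and every
`S ⊆ A` with `|S| ≤ |A|/2` satisfies `|N(S)| ≥ (1+ε)|S|`. -/
def BipartiteExpander {V : Type*} (G : SimpleGraph V) (A B : Set V) (ε : ℝ) : Prop :=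
  IsBipartition G A B ∧ A.ncard = B.ncard ∧
  ∀ S ⊆ A, (S.ncard : ℝ) ≤ (A.ncard : ℝ) / 2 →
    (1 + ε) * (S.ncard : ℝ) ≤ ((Nbhd G S).ncard : ℝ)

/-- `Z` is a separator of `G`: every connected component of `G − Z` has at most
`|V(G)|/2` vertices. -/
def IsSeparator {V : Type*} [Fintype V] (G : SimpleGraph V) (Z : Set V) : Prop :=
  ∀ c : (SimpleGraph.induce Zᶜ G).ConnectedComponent,
    ((c.supp).ncard : ℝ) ≤ (Fintype.card V : ℝ) / 2

/-- `U` avoids `Z` and is closed under adjacency in `G − Z`, that is, `U` is a union of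
connected components of `G − Z`. -/
def IsComponentUnion {V : Type*} (G : SimpleGraph V) (Z U : Set V) : Prop :=
  Disjoint U Z ∧ ∀ x ∈ U, ∀ y, G.Adj x y → y ∉ Z → y ∈ U

theorem IsComponentUnion.union {V : Type*} {G : SimpleGraph V} {Z U W : Set V}
    (hU : IsComponentUnion G Z U) (hW : IsComponentUnion G Z W) :
    IsComponentUnion G Z (U ∪ W) := by
  refine ⟨hU.1.union_left hW.1, ?_⟩
  rintro x (hx | hx) y hxy hy
  · exact Or.inl (hU.2 x hx y hxy hy)
  · exact Or.inr (hW.2 x hx y hxy hy)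

theorem IsComponentUnion.compl {V : Type*} {G : SimpleGraph V} {Z U : Set V}
    (hU : IsComponentUnion G Z U) : IsComponentUnion G Z (U ∪ Z)ᶜ := by
  constructor
  · exact Set.disjoint_left.2 fun x hx hz => hx (Or.inr hz)
  · rintro x hx y hxy hy (hyU | hyZ)
    · exact hx (Or.inl (hU.2 y hyU x hxy.symm fun hz => hx (Or.inr hz)))
    · exact hy hyZ

theorem IsComponentUnion.sdiff {V : Type*} {G : SimpleGraph V} {Z U W : Set V}
    (hU : IsComponentUnion G Z U) (hW : IsComponentUnion G Z W) :
    IsComponentUnion G Z (U \ W) :=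
  ⟨hU.1.mono_left Set.sdiff_subset, fun x hx y hxy hy =>
    ⟨hU.2 x hx.1 y hxy hy, fun hyW =>
      hx.2 (hW.2 y hyW x hxy.symm (Set.disjoint_left.1 hU.1 hx.1))⟩⟩

theorem isComponentUnion_supp {V : Type*} {G : SimpleGraph V} {Z : Set V}
    (c : (SimpleGraph.induce Zᶜ G).ConnectedComponent) :
    IsComponentUnion G Z (Subtype.val '' c.supp) := by
  constructor
  · rw [Set.disjoint_left]
    rintro _ ⟨x, -, rfl⟩
    exact x.2
  · rintro _ ⟨x, hx, rfl⟩ y hxy hy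
    refine ⟨⟨y, hy⟩, ?_, rfl⟩
    have hadj : (SimpleGraph.induce Zᶜ G).Adj x ⟨y, hy⟩ := hxy
    rw [SimpleGraph.ConnectedComponent.mem_supp_iff] at hx ⊢
    rw [← hx]
    exact SimpleGraph.ConnectedComponent.sound hadj.symm.reachable

theorem BipartiteExpander.mul_ncard_le {V : Type*} [Finite V] {G : SimpleGraph V}
    {A B Z U S : Set V} {ε : ℝ} (hexp : BipartiteExpander G A B ε)
    (hU : IsComponentUnion G Z U) (hSA : S ⊆ A) (hSU : S ⊆ U)
    (hS : (S.ncard : ℝ) ≤ (A.ncard : ℝ) / 2) :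
    (1 + ε) * (S.ncard : ℝ) ≤ ((B ∩ U).ncard : ℝ) + ((B ∩ Z).ncard : ℝ) := by
  obtain ⟨⟨-, hdisj, hadj⟩, -, hN⟩ := hexp
  refine (hN S hSA hS).trans ?_
  have hsub : Nbhd G S ⊆ (B ∩ U) ∪ (B ∩ Z) := by
    rintro y ⟨x, hx, hxy⟩
    have hyB : y ∈ B := by
      rcases hadj x y hxy with h | h
      · exact h.2
      · exact absurd h.1 (Set.disjoint_left.1 hdisj (hSA hx))
    by_cases hy : y ∈ Z
    · exact Or.inr ⟨hyB, hy⟩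
    · exact Or.inl ⟨hyB, hU.2 x (hSU hx) y hxy hy⟩
  exact_mod_cast (Set.ncard_le_ncard hsub (Set.toFinite _)).trans (Set.ncard_union_le _ _)

theorem IsBipartition.ncard_eq {V : Type*} [Finite V] {G : SimpleGraph V} {A B : Set V}
    (h : IsBipartition G A B) (U : Set V) :
    U.ncard = (A ∩ U).ncard + (B ∩ U).ncard := by
  rw [← Set.ncard_union_eq (h.2.1.mono Set.inter_subset_left Set.inter_subset_left)
    (Set.toFinite _) (Set.toFinite _), ← Set.union_inter_distrib_right, h.1, Set.univ_inter]

theorem ncard_inter_union {V : Type*} [Finite V] (X : Set V) {U W : Set V}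
    (h : Disjoint U W) : (X ∩ (U ∪ W)).ncard = (X ∩ U).ncard + (X ∩ W).ncard := by
  rw [Set.inter_union_distrib_left]
  exact Set.ncard_union_eq (h.mono Set.inter_subset_right Set.inter_subset_right)
    (Set.toFinite _) (Set.toFinite _)

theorem ncard_inter_add_compl {V : Type*} [Finite V] (X U : Set V) :
    (X ∩ U).ncard + (X ∩ Uᶜ).ncard = X.ncard := by
  rw [← ncard_inter_union X disjoint_compl_right, Set.union_compl_self, Set.inter_univ]

/-- A union of components with at most half of all vertices, but more than half of `A`,
forces `Z` to be large. -/
theorem BipartiteExpander.le_ncard_of_lt {V : Type*} [Finite V] {G : SimpleGraph V}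
    {A B Z U : Set V} {ε : ℝ} (hε : 0 ≤ ε) (hexp : BipartiteExpander G A B ε)
    (hU : IsComponentUnion G Z U) (hcard : U.ncard ≤ A.ncard)
    (hlt : A.ncard < 2 * (A ∩ U).ncard) :
    ε / 2 * ((A.ncard : ℝ) - 1) ≤ (Z.ncard : ℝ) := by
  obtain ⟨S, hSU, hS⟩ := Set.exists_subset_card_eq
    (show A.ncard / 2 ≤ (A ∩ U).ncard by omega)
  have hle : 2 * S.ncard ≤ A.ncard := by omega
  have hge : A.ncard ≤ 2 * S.ncard + 1 := by omega
  have hlt' : S.ncard + 1 ≤ (A ∩ U).ncard := by omega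
  have hsplitU := hexp.1.ncard_eq U
  have hsplitZ := hexp.1.ncard_eq Z
  have hcard' : (A ∩ U).ncard + (B ∩ U).ncard ≤ A.ncard := by omega
  have hZ : (B ∩ Z).ncard ≤ Z.ncard := by omega
  rify at hle hge hlt' hcard' hZ
  have key := hexp.mul_ncard_le hU (hSU.trans Set.inter_subset_left)
    (hSU.trans Set.inter_subset_right) (by linarith)
  nlinarith [mul_le_mul_of_nonneg_left hge hε]

/-- If `V ∖ Z` splits into three unions of components, each with at most half of `A`,
then `Z` is large. -/
theorem BipartiteExpander.le_ncard_of_three {V : Type*} [Finite V] {G : SimpleGraph V}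
    {A B Z U W : Set V} {ε : ℝ} (hε1 : ε ≤ 1)
    (hexp : BipartiteExpander G A B ε)
    (hU : IsComponentUnion G Z U) (hW : IsComponentUnion G Z W) (hUW : Disjoint U W)
    (hAU : 2 * (A ∩ U).ncard ≤ A.ncard) (hAW : 2 * (A ∩ W).ncard ≤ A.ncard)
    (hA : 2 * (A ∩ (U ∪ W ∪ Z)ᶜ).ncard ≤ A.ncard) :
    ε / 2 * (A.ncard : ℝ) ≤ (Z.ncard : ℝ) := by
  have hsplit (X : Set V) : (X ∩ U).ncard + (X ∩ W).ncard + (X ∩ Z).ncard +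
      (X ∩ (U ∪ W ∪ Z)ᶜ).ncard = X.ncard := by
    rw [← ncard_inter_union X hUW, ← ncard_inter_union X (hU.union hW).1,
      ncard_inter_add_compl]
  have hAsum := hsplit A
  have hBsum := hsplit B
  rw [← hexp.2.1] at hBsum
  have hZ := hexp.1.ncard_eq Z
  rify at hAU hAW hA hAsum hBsum hZ
  have k1 := hexp.mul_ncard_le hU Set.inter_subset_left Set.inter_subset_right
    (S := A ∩ U) (by linarith)
  have k2 := hexp.mul_ncard_le hW Set.inter_subset_left Set.inter_subset_right
    (S := A ∩ W) (by linarith)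
  have k3 := hexp.mul_ncard_le (hU.union hW).compl Set.inter_subset_left
    Set.inter_subset_right (S := A ∩ (U ∪ W ∪ Z)ᶜ) (by linarith)
  have hεZ : ε * ((A ∩ Z).ncard : ℝ) ≤ (A ∩ Z).ncard :=
    mul_le_of_le_one_left (Nat.cast_nonneg _) hε1
  have hεsum := congrArg (ε * ·) hAsum
  simp only [mul_add] at hεsum
  linarith

/-- If `G` is a bipartite `ε`-expander with `2n` vertices (classes of size
`n = |A| = |B|`), then every separator `Z` of `G` satisfies
`|Z| ≥ (ε/2)(n − 1) − 1`. -/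
theorem stmt16 {V : Type*} [Fintype V] (G : SimpleGraph V) (A B : Set V)
    (ε : ℝ) (hε0 : 0 < ε) (hε1 : ε ≤ 1)
    (hexp : BipartiteExpander G A B ε)
    (Z : Set V) (hsep : IsSeparator G Z) :
    ε / 2 * ((A.ncard : ℝ) - 1) - 1 ≤ (Z.ncard : ℝ) := by
  have hcardV : Fintype.card V = 2 * A.ncard := by
    have h := hexp.1.ncard_eq Set.univ
    rw [Set.inter_univ, Set.inter_univ, ← hexp.2.1, Set.ncard_univ,
      Nat.card_eq_fintype_card] at h
    omega
  by_cases hbig : ∃ U, IsComponentUnion G Z U ∧ U.ncard ≤ A.ncard ∧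
      A.ncard < 2 * (A ∩ U).ncard
  · obtain ⟨U, hU, hcard, hlt⟩ := hbig
    linarith [hexp.le_ncard_of_lt hε0.le hU hcard hlt]
  push Not at hbig
  suffices h : ε / 2 * (A.ncard : ℝ) ≤ (Z.ncard : ℝ) by linarith
  obtain ⟨U, ⟨hU, hAU⟩, hmax⟩ := Set.Finite.exists_maximal
    (Set.toFinite {U : Set V | IsComponentUnion G Z U ∧ 2 * (A ∩ U).ncard ≤ A.ncard})
    ⟨∅, ⟨Set.empty_disjoint Z, fun x hx => hx.elim⟩, by simp⟩
  by_cases hall : ∀ v, v ∈ U ∪ Z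
  · refine hexp.le_ncard_of_three hε1 hU (W := ∅)
      ⟨Set.empty_disjoint Z, fun x hx => hx.elim⟩ (Set.disjoint_empty U) hAU (by simp) ?_
    simp [Set.eq_univ_of_forall hall]
  push Not at hall
  obtain ⟨v, hv⟩ := hall
  have hvZ : v ∈ Zᶜ := fun h => hv (Or.inr h)
  set c := (SimpleGraph.induce Zᶜ G).connectedComponentMk ⟨v, hvZ⟩
  have hC := isComponentUnion_supp c
  have hCcard : (Subtype.val '' c.supp : Set V).ncard ≤ A.ncard := by
    rw [Set.ncard_image_of_injective _ Subtype.val_injective]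
    have h := hsep c
    rw [hcardV] at h
    push_cast at h
    rify
    linarith
  have hW := hC.sdiff hU
  have hAC := hbig _ hC hCcard
  have hAW := Set.ncard_le_ncard (Set.inter_subset_inter_right A
    (Set.sdiff_subset (s := Subtype.val '' c.supp) (t := U))) (Set.toFinite _)
  refine hexp.le_ncard_of_three hε1 hU hW Set.disjoint_sdiff_right hAU (by omega) ?_
  have hlt : A.ncard < 2 * (A ∩ (U ∪ Subtype.val '' c.supp \ U)).ncard := by
    by_contra hle
    have hvU := hmax (y := U ∪ Subtype.val '' c.supp \ U) ⟨hU.union hW, by omega⟩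
      Set.subset_union_left
    exact hv (Or.inl (hvU (Or.inr ⟨⟨⟨v, hvZ⟩, rfl, rfl⟩, fun h => hv (Or.inl h)⟩)))
  have hsum := ncard_inter_add_compl A (U ∪ Subtype.val '' c.supp \ U)
  have hrest := Set.ncard_le_ncard (Set.inter_subset_inter_right A (Set.compl_subset_compl.2
    (Set.subset_union_left (s := U ∪ Subtype.val '' c.supp \ U) (t := Z)))) (Set.toFinite _)
  omega
end
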